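/- arXiv:2408.05015 — 3 statements merged into one kernel-verified Lean document; each statement's English description precedes it below -/
import Mathlib

section
/- Let B be a nondegenerate alternating bilinear form on F_q^{2n} with n ≥ 2, let X be a point, and let i ∈ {1,…,2n}. Then the number of maximal isotropic flags of type i with respect to X equals c(n−1,1)·q^{i−1}, i.e. |C_i^X| = q^{i−1}·∏_{k=1}^{n−1} (q^{2k}−1)/(q−1). -/
open Matrix

/-- A maximal isotropic flag for the bilinear form `B` on `F^(2n)`: a chain
`U 0 ⊆ U 1 ⊆ ⋯ ⊆ U n` with `dim (U k) = k` (so `U 0 = ⊥`) whose top member (and hence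
every member) is totally isotropic. -/
def SympFlag (F : Type) [Field F] (n : ℕ) (B : LinearMap.BilinForm F (Fin (2 * n) → F)) :
    Type :=
  {U : Fin (n + 1) → Submodule F (Fin (2 * n) → F) //
    Monotone U ∧ (∀ k : Fin (n + 1), Module.finrank F (U k) = (k : ℕ)) ∧
    ∀ x ∈ U (Fin.last n), ∀ y ∈ U (Fin.last n), B x y = 0}

/-- The `k`-th member (for `k : ℕ`, `1`-based) of the chain
`U_1 ⊆ ⋯ ⊆ U_n ⊆ U_(n-1)^⊥ ⊆ ⋯ ⊆ U_1^⊥`; equal to `⊤` for `k ≥ 2n`. -/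
noncomputable def sympMem {F : Type} [Field F] {n : ℕ}
    {B : LinearMap.BilinForm F (Fin (2 * n) → F)} (c : SympFlag F n B) (k : ℕ) :
    Submodule F (Fin (2 * n) → F) :=
  if h : k ≤ n then c.1 ⟨k, by omega⟩
  else if h2 : k ≤ 2 * n - 1 then B.orthogonal (c.1 ⟨2 * n - k, by omega⟩)
  else ⊤

/-- The type of a maximal isotropic flag with respect to a point `X`: the smallest `k`
such that `X` is contained in the `k`-th member of the chain
`U_1 ⊆ ⋯ ⊆ U_n ⊆ U_(n-1)^⊥ ⊆ ⋯ ⊆ U_1^⊥`, and `2n` if `X ⊄ U_1^⊥`. -/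
noncomputable def sympType {F : Type} [Field F] {n : ℕ}
    {B : LinearMap.BilinForm F (Fin (2 * n) → F)} (c : SympFlag F n B)
    (X : Submodule F (Fin (2 * n) → F)) : ℕ :=
  sInf {k : ℕ | X ≤ sympMem c k}

/-- `c(k,1) = ∏_{i=1}^{k} (q^(2i)-1)/(q-1)`. -/
noncomputable def cB (q : ℚ) (k : ℕ) : ℚ :=
  ∏ i ∈ Finset.Icc 1 k, (q ^ (2 * i) - 1) / (q - 1)

open Module

section Extensions

variable {F V : Type*} [Field F] [AddCommGroup V] [Module F V]

/-- The subspaces of `Y` that contain `W` with codimension one. -/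
def extensions (W Y : Submodule F V) : Set (Submodule F V) :=
  {U | W ≤ U ∧ U ≤ Y ∧ finrank F U = finrank F W + 1}

theorem extensions_mono (W : Submodule F V) {Y Z : Submodule F V} (h : Y ≤ Z) :
    extensions W Y ⊆ extensions W Z :=
  fun _ hU => ⟨hU.1, hU.2.1.trans h, hU.2.2⟩

theorem finrank_sup_of_finrank_eq_one [FiniteDimensional F V] {W X : Submodule F V}
    (hX : finrank F X = 1) (hXW : ¬ X ≤ W) : finrank F (W ⊔ X : Submodule F V) = finrank F W + 1 := by
  have h := Submodule.finrank_sup_add_finrank_inf_eq W X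
  have hlt : finrank F (W ⊓ X : Submodule F V) < finrank F X :=
    Submodule.finrank_lt_finrank_of_lt
      (lt_of_le_of_ne inf_le_right fun e => hXW (inf_eq_right.1 e))
  omega

theorem sup_mem_extensions [FiniteDimensional F V] {W X Y : Submodule F V}
    (hX : finrank F X = 1) (hXW : ¬ X ≤ W) (hW : W ≤ Y) (hXY : X ≤ Y) :
    W ⊔ X ∈ extensions W Y :=
  ⟨le_sup_left, sup_le hW hXY, finrank_sup_of_finrank_eq_one hX hXW⟩

theorem eq_sup_of_mem_extensions [FiniteDimensional F V] {W X Y U : Submodule F V}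
    (hX : finrank F X = 1) (hXW : ¬ X ≤ W) (hU : U ∈ extensions W Y) (hXU : X ≤ U) :
    W ⊔ X = U :=
  Submodule.eq_of_le_of_finrank_eq (sup_le hU.1 hXU)
    ((finrank_sup_of_finrank_eq_one hX hXW).trans hU.2.2.symm)

theorem card_sdiff_submodule [Fintype F] [Finite V] {W U : Submodule F V} (h : W ≤ U) :
    (((U : Set V) \ W).ncard : ℚ) =
      (Fintype.card F : ℚ) ^ finrank F U - (Fintype.card F : ℚ) ^ finrank F W := by
  have hc (Z : Submodule F V) : (Z : Set V).ncard = Fintype.card F ^ finrank F Z := by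
    have := Fintype.ofFinite Z
    rw [← card_eq_pow_finrank (K := F) (V := Z), ← Nat.card_eq_fintype_card]
    rfl
  have := Set.ncard_sdiff_add_ncard_of_subset (s := (W : Set V)) (t := U) h
  rw [hc, hc] at this
  rw [eq_sub_iff_add_eq]
  exact_mod_cast this

theorem ncard_extensions [Fintype F] [Finite V] {W Y : Submodule F V} (h : W ≤ Y) {d : ℕ}
    (hd : finrank F Y = finrank F W + d) :
    ((extensions W Y).ncard : ℚ) =
      ((Fintype.card F : ℚ) ^ d - 1) / ((Fintype.card F : ℚ) - 1) := by
  classical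
  have hf : ∀ v ∈ (Set.toFinite ((Y : Set V) \ W)).toFinset,
      W ⊔ F ∙ v ∈ (Set.toFinite (extensions W Y)).toFinset := by
    intro v hv
    simp only [Set.Finite.mem_toFinset, Set.mem_sdiff, SetLike.mem_coe] at hv ⊢
    exact sup_mem_extensions
      (finrank_span_singleton fun e => hv.2 (e ▸ W.zero_mem)) (by simpa using hv.2) h
      (by simpa using hv.1)
  have key := Finset.card_eq_sum_card_fiberwise hf
  have hfib : ∀ U ∈ (Set.toFinite (extensions W Y)).toFinset,
      (((Set.toFinite ((Y : Set V) \ W)).toFinset.filter fun v => W ⊔ F ∙ v = U).card : ℚ) =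
        (Fintype.card F : ℚ) ^ (finrank F W + 1) - (Fintype.card F : ℚ) ^ finrank F W := by
    intro U hU
    rw [Set.Finite.mem_toFinset] at hU
    rw [← hU.2.2, ← card_sdiff_submodule hU.1, ← Set.ncard_coe_finset]
    congr 2
    ext v
    simp only [Finset.coe_filter, Set.Finite.mem_toFinset, Set.mem_sdiff, SetLike.mem_coe,
      Set.mem_ofPred_eq]
    constructor
    · rintro ⟨⟨-, hvW⟩, rfl⟩
      exact ⟨Submodule.mem_sup_right (Submodule.mem_span_singleton_self v), hvW⟩
    · rintro ⟨hvU, hvW⟩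
      exact ⟨⟨hU.2.1 hvU, hvW⟩, eq_sup_of_mem_extensions
        (finrank_span_singleton fun e => hvW (e ▸ W.zero_mem)) (by simpa using hvW) hU
        (by simpa using hvU)⟩
  rw [← Set.ncard_eq_toFinset_card] at key
  have key' := congrArg (Nat.cast : ℕ → ℚ) key
  rw [card_sdiff_submodule h, Nat.cast_sum, Finset.sum_congr rfl hfib, Finset.sum_const,
    ← Set.ncard_eq_toFinset_card, hd, nsmul_eq_mul] at key'
  have hq : (1 : ℚ) < Fintype.card F := by exact_mod_cast Fintype.one_lt_card
  have hq0 : (Fintype.card F : ℚ) ^ finrank F W ≠ 0 := by positivity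
  rw [eq_div_iff (by linarith)]
  apply mul_left_cancel₀ hq0
  rw [pow_add, pow_succ] at key'
  linear_combination -key'

end Extensions

section Chains

variable {F V : Type*} [Field F] [AddCommGroup V] [Module F V]

/-- A chain of totally isotropic subspaces `W = U 0 ⊆ ⋯ ⊆ U m` whose dimensions increase by one
at each step. -/
structure IsIsotropicChain (B : LinearMap.BilinForm F V) (m : ℕ) (W : Submodule F V)
    (U : Fin (m + 1) → Submodule F V) : Prop where
  zero : U 0 = W
  mono : Monotone U
  finrank_eq : ∀ k, finrank F (U k) = finrank F W + k
  isotropic : U (Fin.last m) ≤ B.orthogonal (U (Fin.last m))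

/-- The `k`-th member of the chain `U 0 ⊆ ⋯ ⊆ U m ⊆ (U (m - 1))ᗮ ⊆ ⋯ ⊆ (U 0)ᗮ`. -/
noncomputable def chainMem (B : LinearMap.BilinForm F V) {m : ℕ}
    (U : Fin (m + 1) → Submodule F V) (k : ℕ) : Submodule F V :=
  if h : k ≤ m then U ⟨k, by omega⟩ else B.orthogonal (U ⟨2 * m - k, by omega⟩)

variable {B : LinearMap.BilinForm F V} {m : ℕ} {W X : Submodule F V}

theorem chainMem_zero (U : Fin (m + 1) → Submodule F V) : chainMem B U 0 = U 0 := by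
  simp [chainMem]

theorem chainMem_two_mul_succ (U : Fin (m + 2) → Submodule F V) :
    chainMem B U (2 * (m + 1)) = B.orthogonal (U 0) := by
  rw [chainMem, dif_neg (by omega)]
  congr 2
  ext
  simp

theorem chainMem_succ (U : Fin (m + 2) → Submodule F V) {k : ℕ} (hk : k ≤ 2 * m) :
    chainMem B U (k + 1) = chainMem B (Fin.tail U) k := by
  unfold chainMem Fin.tail
  by_cases h : k ≤ m
  · rw [dif_pos h, dif_pos (by omega)]
    rfl
  · rw [dif_neg h, dif_neg (by omega)]
    congr 2
    ext
    simp only [Fin.val_succ]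
    omega

theorem IsIsotropicChain.le_orthogonal {U : Fin (m + 1) → Submodule F V}
    (hU : IsIsotropicChain B m W U) (i j : Fin (m + 1)) : U i ≤ B.orthogonal (U j) :=
  ((hU.mono (Fin.le_last i)).trans hU.isotropic).trans
    (LinearMap.BilinForm.orthogonal_le (hU.mono (Fin.le_last j)))

theorem IsIsotropicChain.chainMem_mono {U : Fin (m + 1) → Submodule F V}
    (hU : IsIsotropicChain B m W U) : Monotone (chainMem B U) := by
  intro a b hab
  unfold chainMem
  split_ifs with ha hb hb
  · exact hU.mono hab
  · exact hU.le_orthogonal _ _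
  · omega
  · exact LinearMap.BilinForm.orthogonal_le (hU.mono (Fin.mk_le_mk.2 (by omega)))

theorem IsIsotropicChain.chainMem_le {U : Fin (m + 1) → Submodule F V}
    (hU : IsIsotropicChain B m W U) (k : ℕ) : chainMem B U k ≤ B.orthogonal W := by
  unfold chainMem
  split_ifs
  · exact hU.zero ▸ hU.le_orthogonal _ _
  · exact LinearMap.BilinForm.orthogonal_le (hU.zero ▸ hU.mono (Fin.zero_le _))

theorem IsIsotropicChain.chainMem_two_mul {U : Fin (m + 1) → Submodule F V}
    (hU : IsIsotropicChain B m W U) (hW : m = 0 → B.orthogonal W = W) :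
    chainMem B U (2 * m) = B.orthogonal W := by
  cases m with
  | zero => rw [hW rfl, ← hU.zero, Nat.mul_zero, chainMem_zero]
  | succ m => rw [chainMem_two_mul_succ, hU.zero]

theorem isIsotropicChain_zero_iff {U : Fin 1 → Submodule F V} :
    IsIsotropicChain B 0 W U ↔ U = (fun _ => W) ∧ W ≤ B.orthogonal W := by
  constructor
  · intro h
    have h0 := h.zero
    refine ⟨funext fun k => by rw [Subsingleton.elim k 0, h0], ?_⟩
    exact h0 ▸ h.isotropic
  · rintro ⟨rfl, h⟩
    exact ⟨rfl, monotone_const, fun k => by simp, h⟩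

theorem isIsotropicChain_cons_iff {U : Fin (m + 1) → Submodule F V} :
    IsIsotropicChain B (m + 1) W (Fin.cons W U) ↔
      U 0 ∈ extensions W (B.orthogonal W) ∧ IsIsotropicChain B m (U 0) U := by
  constructor
  · intro h
    have h01 : W ≤ U 0 := h.mono (Fin.zero_le 1)
    have hd (k : Fin (m + 1)) : finrank F (U k) = finrank F W + (k + 1) :=
      h.finrank_eq k.succ
    refine ⟨⟨h01, h.le_orthogonal 1 0, by simpa using hd 0⟩, rfl, fun a b hab => ?_, fun k => ?_, ?_⟩
    · exact h.mono (Fin.succ_le_succ_iff.2 hab)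
    · rw [hd, hd]
      simp
      omega
    · simpa [← Fin.succ_last] using h.isotropic
  · rintro ⟨⟨h1, h2, h3⟩, h⟩
    refine ⟨rfl, ?_, ?_, ?_⟩
    · intro a b hab
      induction a using Fin.cases with
      | zero =>
        induction b using Fin.cases with
        | zero => rfl
        | succ b => exact h1.trans (h.mono (Fin.zero_le b))
      | succ a =>
        induction b using Fin.cases with
        | zero => exact absurd hab (by simp)
        | succ b => exact h.mono (Fin.succ_le_succ_iff.1 hab)
    · intro k
      induction k using Fin.cases with
      | zero => rfl
      | succ k =>
        rw [Fin.cons_succ, h.finrank_eq, h3, Fin.val_succ]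
        omega
    · simpa [← Fin.succ_last] using h.isotropic

theorem IsIsotropicChain.cons_tail {U : Fin (m + 2) → Submodule F V}
    (hU : IsIsotropicChain B (m + 1) W U) : Fin.cons W (Fin.tail U) = U := by
  rw [← hU.zero, Fin.cons_self_tail]

theorem ncard_isIsotropicChain_succ [Finite V]
    (P : (Fin (m + 1) → Submodule F V) → Prop) (S : Set (Submodule F V))
    (hS : S ⊆ extensions W (B.orthogonal W)) (c : ℚ)
    (hc : ∀ U₁ ∈ S, ({U | IsIsotropicChain B m U₁ U ∧ P U}.ncard : ℚ) = c)
    (hP : ∀ U₁ ∈ extensions W (B.orthogonal W), ∀ U, IsIsotropicChain B m U₁ U → P U → U₁ ∈ S) :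
    ({U | IsIsotropicChain B (m + 1) W U ∧ P (Fin.tail U)}.ncard : ℚ) = S.ncard * c := by
  let e : {U | IsIsotropicChain B (m + 1) W U ∧ P (Fin.tail U)} ≃
      Σ U₁ : S, {U | IsIsotropicChain B m U₁ U ∧ P U} :=
    { toFun := fun U =>
        have h := (isIsotropicChain_cons_iff (U := Fin.tail U.1)).1 (by
          rw [U.2.1.cons_tail]; exact U.2.1)
        ⟨⟨Fin.tail U.1 0, hP _ h.1 _ h.2 U.2.2⟩, Fin.tail U.1, h.2, U.2.2⟩
      invFun := fun U => ⟨Fin.cons W U.2.1, by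
        have h := U.2.2.1
        refine ⟨(isIsotropicChain_cons_iff).2 ?_, ?_⟩
        · rw [h.zero]
          exact ⟨hS U.1.2, h⟩
        rw [Fin.tail_cons]
        exact U.2.2.2⟩
      left_inv := fun U => Subtype.ext U.2.1.cons_tail
      right_inv := by
        rintro ⟨⟨U₁, h₁⟩, U, hU⟩
        obtain rfl := hU.1.zero
        rfl }
  have := Fintype.ofFinite S
  rw [← Nat.card_coe_set_eq, Nat.card_congr e, Nat.card_sigma, Nat.cast_sum,
    Finset.sum_congr rfl fun U₁ _ => (Nat.card_coe_set_eq _ ▸ hc U₁ U₁.2 : _ = c),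
    Finset.sum_const, nsmul_eq_mul, Finset.card_univ, ← Nat.card_eq_fintype_card,
    Nat.card_coe_set_eq]

theorem le_orthogonal_comm (hB : B.IsRefl) {U : Submodule F V} :
    W ≤ B.orthogonal U ↔ U ≤ B.orthogonal W :=
  ⟨fun h _ hu _ hw => hB _ _ (h hw _ hu), fun h _ hw _ hu => hB _ _ (h hu _ hw)⟩

theorem le_orthogonal_sup_iff (hB : B.IsRefl) {U : Submodule F V} :
    U ≤ B.orthogonal (W ⊔ X) ↔ U ≤ B.orthogonal W ∧ U ≤ B.orthogonal X := by
  rw [← le_orthogonal_comm hB, sup_le_iff, le_orthogonal_comm hB, le_orthogonal_comm hB (W := X)]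

theorem le_orthogonal_self_of_mem_extensions [FiniteDimensional F V] (hB : B.IsAlt)
    (hW : W ≤ B.orthogonal W) {U : Submodule F V} (hU : U ∈ extensions W (B.orthogonal W)) :
    U ≤ B.orthogonal U := by
  obtain ⟨v, hvU, hvW⟩ : ∃ v ∈ U, v ∉ W := by
    by_contra! h
    have := Submodule.finrank_mono (R := F) (show U ≤ W from h)
    have := hU.2.2
    omega
  have hsup : W ⊔ F ∙ v = U :=
    eq_sup_of_mem_extensions (finrank_span_singleton fun e => hvW (e ▸ W.zero_mem))
      (by simpa using hvW) hU (by simpa using hvU)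
  have hv : F ∙ v ≤ B.orthogonal (F ∙ v) := by
    rw [Submodule.span_singleton_le_iff_mem]
    intro w hw
    obtain ⟨a, rfl⟩ := Submodule.mem_span_singleton.1 hw
    simp [hB.self_eq_zero]
  have hvW' : F ∙ v ≤ B.orthogonal W := by simpa using hU.2.1 hvU
  rw [← hsup, le_orthogonal_sup_iff hB.isRefl]
  exact ⟨sup_le hW hvW', sup_le ((le_orthogonal_comm hB.isRefl).1 hvW') hv⟩

theorem finrank_orthogonal_eq [FiniteDimensional F V] (hnd : B.Nondegenerate) {a : ℕ}
    (hV : finrank F V = finrank F W + a) : finrank F (B.orthogonal W) = a := by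
  rw [LinearMap.BilinForm.finrank_orthogonal hnd, hV, Nat.add_sub_cancel_left]

theorem ncard_isIsotropicChain [Fintype F] [Finite V] (hnd : B.Nondegenerate) (hB : B.IsAlt)
    (hW : W ≤ B.orthogonal W) (hV : finrank F V = 2 * (finrank F W + m)) :
    ({U | IsIsotropicChain B m W U}.ncard : ℚ) =
      ∏ k ∈ Finset.Icc 1 m,
        ((Fintype.card F : ℚ) ^ (2 * k) - 1) / ((Fintype.card F : ℚ) - 1) := by
  induction m generalizing W with
  | zero => simp [isIsotropicChain_zero_iff, hW]
  | succ m ih =>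
    have h := ncard_isIsotropicChain_succ (m := m) (fun _ => True)
      (extensions W (B.orthogonal W)) subset_rfl _
      (fun U₁ hU₁ => by
        simp only [and_true]
        exact ih (le_orthogonal_self_of_mem_extensions hB hW hU₁) (by rw [hV, hU₁.2.2]; ring))
      (fun _ h _ _ _ => h)
    simp only [and_true] at h
    rw [h, Finset.prod_Icc_succ_top (by omega), mul_comm,
      ncard_extensions hW (d := 2 * (m + 1)) (finrank_orthogonal_eq hnd (by omega))]

theorem ncard_isIsotropicChain_chainMem [Fintype F] [Finite V] (hnd : B.Nondegenerate)
    (hB : B.IsAlt) (hX : finrank F X = 1) (hW : W ≤ B.orthogonal W) (hXW : ¬ X ≤ W)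
    (hXW' : X ≤ B.orthogonal W) (hV : finrank F V = 2 * (finrank F W + m)) {j : ℕ}
    (hj : j < 2 * m) :
    ({U | IsIsotropicChain B m W U ∧ X ≤ chainMem B U (j + 1) ∧ ¬ X ≤ chainMem B U j}.ncard : ℚ) =
      (Fintype.card F : ℚ) ^ j * ∏ k ∈ Finset.Icc 1 (m - 1),
        ((Fintype.card F : ℚ) ^ (2 * k) - 1) / ((Fintype.card F : ℚ) - 1) := by
  induction m generalizing W j with
  | zero => omega
  | succ m ih =>
    have hq : (1 : ℚ) < Fintype.card F := by exact_mod_cast Fintype.one_lt_card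
    have hq1 : (Fintype.card F : ℚ) - 1 ≠ 0 := by linarith
    have hX' : X ≤ B.orthogonal X :=
      le_orthogonal_self_of_mem_extensions hB bot_le (W := ⊥) ⟨bot_le, by simp, by simp [hX]⟩
    have hWX : W ≤ B.orthogonal X := (le_orthogonal_comm hB.isRefl).1 hXW'
    have hWY : W ≤ B.orthogonal (W ⊔ X) := (le_orthogonal_sup_iff hB.isRefl).2 ⟨hW, hWX⟩
    have hY : B.orthogonal (W ⊔ X) ≤ B.orthogonal W :=
      LinearMap.BilinForm.orthogonal_le le_sup_left
    have hsup : W ⊔ X ∈ extensions W (B.orthogonal (W ⊔ X)) :=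
      sup_mem_extensions hX hXW hWY ((le_orthogonal_sup_iff hB.isRefl).2 ⟨hXW', hX'⟩)
    have hcard : ((extensions W (B.orthogonal (W ⊔ X))).ncard : ℚ) =
        ((Fintype.card F : ℚ) ^ (2 * m + 1) - 1) / ((Fintype.card F : ℚ) - 1) :=
      ncard_extensions hWY (finrank_orthogonal_eq hnd (by rw [hsup.2.2]; omega))
    have hcard' : ((extensions W (B.orthogonal W)).ncard : ℚ) =
        ((Fintype.card F : ℚ) ^ (2 * m + 2) - 1) / ((Fintype.card F : ℚ) - 1) :=
      ncard_extensions hW (finrank_orthogonal_eq hnd (by omega))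
    have hiso {U₁ : Submodule F V} (h : U₁ ∈ extensions W (B.orthogonal W)) :
        U₁ ≤ B.orthogonal U₁ := le_orthogonal_self_of_mem_extensions hB hW h
    have hdim {U₁ : Submodule F V} (h : U₁ ∈ extensions W (B.orthogonal W)) :
        finrank F V = 2 * (finrank F U₁ + m) := by rw [hV, h.2.2]; ring
    have hmem {U₁ : Submodule F V} (h : U₁ ∈ extensions W (B.orthogonal W)) :
        U₁ ∈ extensions W (B.orthogonal (W ⊔ X)) ↔ X ≤ B.orthogonal U₁ := by
      rw [le_orthogonal_comm hB.isRefl]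
      exact ⟨fun h' => ((le_orthogonal_sup_iff hB.isRefl).1 h'.2.1).2,
        fun h' => ⟨h.1, (le_orthogonal_sup_iff hB.isRefl).2 ⟨h.2.1, h'⟩, h.2.2⟩⟩
    have htop {U₁ : Submodule F V} (h : U₁ ∈ extensions W (B.orthogonal W))
        {U : Fin (m + 1) → Submodule F V} (hU : IsIsotropicChain B m U₁ U) :
        chainMem B U (2 * m) = B.orthogonal U₁ := by
      refine hU.chainMem_two_mul fun hm => ?_
      have := hdim h
      exact (Submodule.eq_of_le_of_finrank_eq (hiso h)
        (finrank_orthogonal_eq hnd (by omega)).symm).symm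
    rw [Nat.add_sub_cancel]
    rcases Nat.eq_zero_or_pos j with rfl | hj0
    · have h := ncard_isIsotropicChain_succ (m := m) (fun U => X ≤ U 0) {W ⊔ X}
        (Set.singleton_subset_iff.2 (extensions_mono W hY hsup)) _
        (fun U₁ hU₁ => by
          refine Eq.trans ?_ (ncard_isIsotropicChain hnd hB (hiso (extensions_mono W hY hsup))
            (hdim (extensions_mono W hY hsup)))
          rw [Set.mem_singleton_iff] at hU₁
          congr 3
          ext U
          rw [hU₁]
          exact and_iff_left_of_imp fun hU => hU.zero ▸ le_sup_right)
        (fun U₁ hU₁ U hU hXU =>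
          (eq_sup_of_mem_extensions hX hXW hU₁ (hU.zero ▸ hXU)).symm)
      rw [Set.ncard_singleton, Nat.cast_one, one_mul] at h
      rw [pow_zero, one_mul, ← h]
      congr 3
      ext U
      refine and_congr_right fun hU => ?_
      rw [chainMem_zero, hU.zero, chainMem_succ U (Nat.zero_le _), chainMem_zero]
      exact and_iff_left hXW
    obtain ⟨j, rfl⟩ := Nat.exists_eq_add_one.2 hj0
    rcases Nat.lt_or_ge j (2 * m) with hjm | hjm
    · have h := ncard_isIsotropicChain_succ (m := m)
        (fun U => X ≤ chainMem B U (j + 1) ∧ ¬ X ≤ chainMem B U j)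
        (extensions W (B.orthogonal (W ⊔ X)) \ {W ⊔ X})
        (Set.sdiff_subset.trans (extensions_mono W hY)) _
        (fun U₁ hU₁ => ih (hiso (extensions_mono W hY hU₁.1))
          (fun hXU => hU₁.2 (eq_sup_of_mem_extensions hX hXW hU₁.1 hXU).symm)
          ((hmem (extensions_mono W hY hU₁.1)).1 hU₁.1) (hdim (extensions_mono W hY hU₁.1)) hjm)
        (fun U₁ hU₁ U hU hXU =>
          ⟨(hmem hU₁).2 (hXU.1.trans (hU.chainMem_le _)), fun e => hXU.2 (by
            refine le_trans ?_ (hU.chainMem_mono (Nat.zero_le j))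
            rw [chainMem_zero, hU.zero, Set.mem_singleton_iff.1 e]
            exact le_sup_right)⟩)
      have hc : ((extensions W (B.orthogonal (W ⊔ X)) \ {W ⊔ X}).ncard : ℚ) =
          Fintype.card F * (((Fintype.card F : ℚ) ^ (2 * m) - 1) / ((Fintype.card F : ℚ) - 1)) := by
        have h1 := Set.ncard_sdiff_singleton_add_one hsup
        have h2 := congrArg (Nat.cast : ℕ → ℚ) h1
        rw [hcard, Nat.cast_add, Nat.cast_one] at h2
        rw [eq_sub_of_add_eq h2]
        field_simp
        ring
      obtain ⟨m, rfl⟩ : ∃ l, m = l + 1 := Nat.exists_eq_add_one.2 (by omega)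
      rw [hc, Nat.add_sub_cancel] at h
      rw [Finset.prod_Icc_succ_top (by omega)]
      trans
      swap
      · refine h.trans ?_
        ring
      congr 3
      ext U
      refine and_congr_right fun hU => ?_
      rw [chainMem_succ U (by omega), chainMem_succ U (by omega)]
    · obtain rfl : j = 2 * m := by omega
      have h := ncard_isIsotropicChain_succ (m := m)
        (fun U => ¬ X ≤ chainMem B U (2 * m))
        (extensions W (B.orthogonal W) \ extensions W (B.orthogonal (W ⊔ X)))
        Set.sdiff_subset _
        (fun U₁ hU₁ => by
          refine Eq.trans ?_ (ncard_isIsotropicChain hnd hB (hiso hU₁.1) (hdim hU₁.1))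
          congr 3
          ext U
          refine and_iff_left_of_imp fun hU => ?_
          rw [htop hU₁.1 hU, ← hmem hU₁.1]
          exact hU₁.2)
        (fun U₁ hU₁ U hU hXU => ⟨hU₁, by rwa [hmem hU₁, ← htop hU₁ hU]⟩)
      have hc : ((extensions W (B.orthogonal W) \
          extensions W (B.orthogonal (W ⊔ X))).ncard : ℚ) = (Fintype.card F : ℚ) ^ (2 * m + 1) := by
        have h1 := Set.ncard_sdiff_add_ncard_of_subset (extensions_mono W hY)
        have h2 := congrArg (Nat.cast : ℕ → ℚ) h1
        rw [Nat.cast_add, hcard, hcard'] at h2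
        rw [eq_sub_of_add_eq h2]
        field_simp
        ring
      rw [hc] at h
      rw [← h]
      congr 3
      ext U
      refine and_congr_right fun hU => ?_
      rw [chainMem_succ U le_rfl, show 2 * m + 1 + 1 = 2 * (m + 1) by ring,
        chainMem_two_mul_succ, hU.zero]
      exact and_iff_right hXW'

end Chains

section SympFlag

variable {F : Type} [Field F] {n : ℕ} {B : LinearMap.BilinForm F (Fin (2 * n) → F)}

theorem SympFlag.isIsotropicChain (hB : B.IsRefl) (c : SympFlag F n B) :
    IsIsotropicChain B n ⊥ c.1 where
  zero := Submodule.finrank_eq_zero.1 (by simpa using c.2.2.1 0)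
  mono := c.2.1
  finrank_eq k := by simpa using c.2.2.1 k
  isotropic x hx y hy := hB _ _ (c.2.2.2 x hx y hy)

/-- Maximal isotropic flags are the isotropic chains of length `n` starting at `⊥`. -/
def sympFlagEquiv (hB : B.IsRefl) : SympFlag F n B ≃ {U // IsIsotropicChain B n ⊥ U} :=
  Equiv.subtypeEquivRight fun U =>
    ⟨fun h => SympFlag.isIsotropicChain hB ⟨U, h⟩,
      fun h => ⟨h.mono, fun k => by simpa using h.finrank_eq k,
        fun x hx y hy => h.isotropic hy x hx⟩⟩

theorem sympMem_eq_chainMem (hB : B.IsRefl) (c : SympFlag F n B) {k : ℕ} (hk : k ≤ 2 * n) :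
    sympMem c k = chainMem B c.1 k := by
  unfold sympMem chainMem
  split_ifs with h1 h2
  · rfl
  · rfl
  · obtain rfl : k = 2 * n := by omega
    have h0 := (c.isIsotropicChain hB).zero
    simp [h0]

theorem sympType_eq_succ_iff (hB : B.IsRefl) (c : SympFlag F n B)
    (X : Submodule F (Fin (2 * n) → F)) {j : ℕ} (hj : j < 2 * n) :
    sympType c X = j + 1 ↔ X ≤ chainMem B c.1 (j + 1) ∧ ¬ X ≤ chainMem B c.1 j := by
  have hmono := (c.isIsotropicChain hB).chainMem_mono
  have hmem {k : ℕ} (hk : k ≤ 2 * n) : k ∈ {k : ℕ | X ≤ sympMem c k} ↔ X ≤ chainMem B c.1 k := by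
    rw [Set.mem_ofPred_eq, sympMem_eq_chainMem hB c hk]
  rw [← hmem (by omega), ← hmem (by omega)]
  unfold sympType
  constructor
  · intro h
    exact ⟨h ▸ Nat.sInf_mem (Nat.nonempty_of_sInf_eq_succ h), Nat.notMem_of_lt_sInf (by omega)⟩
  · rintro ⟨h1, h2⟩
    refine le_antisymm (Nat.sInf_le h1) ?_
    by_contra! hlt
    have hs := Nat.sInf_mem ⟨_, h1⟩
    exact h2 ((hmem (by omega)).2 (((hmem (by omega)).1 hs).trans (hmono (by omega))))

end SympFlag

theorem card_symp_type_i (F : Type) [Field F] [Fintype F] (q : ℕ)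
    (hq : Fintype.card F = q) (n : ℕ) (hn : 2 ≤ n)
    (B : LinearMap.BilinForm F (Fin (2 * n) → F))
    (hB : B.Nondegenerate) (hBalt : ∀ v, B v v = 0)
    (X : Submodule F (Fin (2 * n) → F)) (hX : Module.finrank F X = 1)
    (i : ℕ) (hi1 : 1 ≤ i) (hi2 : i ≤ 2 * n) :
    (Nat.card {c : SympFlag F n B // sympType c X = i} : ℚ) =
      (q : ℚ) ^ (i - 1) *
        ∏ k ∈ Finset.Icc 1 (n - 1), ((q : ℚ) ^ (2 * k) - 1) / ((q : ℚ) - 1) := by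
  subst hq
  have halt : B.IsAlt := hBalt
  obtain ⟨j, rfl⟩ := Nat.exists_eq_add_one.2 hi1
  have hX0 : ¬ X ≤ ⊥ := fun h => by
    obtain rfl := le_bot_iff.1 h
    simp at hX
  rw [Nat.add_sub_cancel, ← ncard_isIsotropicChain_chainMem hB halt hX bot_le hX0 (by simp)
    (by simp) (Nat.lt_of_succ_le hi2), ← Nat.card_coe_set_eq]
  congr 1
  exact Nat.card_congr (((sympFlagEquiv halt.isRefl).subtypeEquiv fun c =>
    sympType_eq_succ_iff halt.isRefl c X hi2).trans
      (Equiv.subtypeSubtypeEquivSubtypeInter _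
        fun U => X ≤ chainMem B U (j + 1) ∧ ¬ X ≤ chainMem B U j))
end

section
/- Let B be a nondegenerate alternating bilinear form on F_q^{2n} with n ≥ 2, let X be a point, let i,j ∈ {1,…,2n}, and let c be a maximal isotropic flag of type i with respect to X. Then the number of maximal isotropic flags of type j with respect to X that are opposite to c equals 0 if i+j < 2n+1, and equals (q−1+δ_{i+j,2n+1})·q^{n(n−2)+j−1} if i+j ≥ 2n+1 (δ denotes the Kronecker delta). -/
open Matrix

/-- Two maximal isotropic flags are opposite when `U_i ∩ V_i^⊥ = 0` for all `i`
(trivial for `i = 0`). -/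
def OppS {F : Type} [Field F] {n : ℕ} {B : LinearMap.BilinForm F (Fin (2 * n) → F)}
    (c d : SympFlag F n B) : Prop :=
  ∀ i : Fin (n + 1), c.1 i ⊓ B.orthogonal (d.1 i) = ⊥

section

open Module

theorem natCard_mul_eq_natCard_mul {α β : Type*} [Finite α] [Finite β] (r : α → β → Prop)
    {m n : ℕ} (hm : ∀ a, Nat.card {b // r a b} = m) (hn : ∀ b, Nat.card {a // r a b} = n) :
    Nat.card α * m = Nat.card β * n := by
  classical
  have := Fintype.ofFinite α
  have := Fintype.ofFinite β
  rw [Nat.card_eq_fintype_card, Nat.card_eq_fintype_card]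
  refine Finset.card_mul_eq_card_mul r (s := Finset.univ) (t := Finset.univ) (fun a _ => ?_)
    (fun b _ => ?_)
  · rw [← hm a, Nat.card_eq_fintype_card, Fintype.card_subtype]; rfl
  · rw [← hn b, Nat.card_eq_fintype_card, Fintype.card_subtype]; rfl

section LinearAlgebra

variable {F V : Type*} [Field F] [AddCommGroup V] [Module F V]

theorem Submodule.natCard_sdiff [Finite F] [FiniteDimensional F V] {A H : Submodule F V}
    (h : H ≤ A) :
    Nat.card {x // x ∈ A ∧ x ∉ H} = Nat.card F ^ finrank F A - Nat.card F ^ finrank F H := by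
  have : Finite V := Module.finite_of_finite F
  have h1 : Nat.card {x // x ∈ A ∧ x ∉ H} = ((A : Set V) \ H).ncard := rfl
  have hA : (A : Set V).ncard = Nat.card F ^ finrank F A := Module.natCard_eq_pow_finrank
  have hH : (H : Set V).ncard = Nat.card F ^ finrank F H := Module.natCard_eq_pow_finrank
  rw [h1, Set.ncard_sdiff (SetLike.coe_subset_coe.2 h), hA, hH]

variable {B : LinearMap.BilinForm F V}

theorem LinearMap.BilinForm.orthogonal_sup (U W : Submodule F V) :
    B.orthogonal (U ⊔ W) = B.orthogonal U ⊓ B.orthogonal W := by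
  refine le_antisymm (le_inf (orthogonal_le le_sup_left) (orthogonal_le le_sup_right)) ?_
  rintro x ⟨hU, hW⟩ y hy
  obtain ⟨u, hu, w, hw, rfl⟩ := Submodule.mem_sup.1 hy
  have h1 : B u x = 0 := hU u hu
  have h2 : B w x = 0 := hW w hw
  simp [h1, h2]

theorem LinearMap.BilinForm.mem_orthogonal_span_singleton {e x : V} :
    x ∈ B.orthogonal (F ∙ e) ↔ B e x = 0 := by
  rw [mem_orthogonal_iff]
  constructor
  · exact fun h => h e (Submodule.mem_span_singleton_self e)
  · intro h y hy
    obtain ⟨a, rfl⟩ := Submodule.mem_span_singleton.1 hy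
    simp [h]

theorem LinearMap.BilinForm.finrank_sup_orthogonal_of_inf_eq_bot [FiniteDimensional F V]
    (hB : B.Nondegenerate) {C U : Submodule F V} (h : C ⊓ B.orthogonal U = ⊥)
    (hd : finrank F C = finrank F U) : C ⊔ B.orthogonal U = ⊤ := by
  apply Submodule.eq_top_of_finrank_eq
  have h1 := Submodule.finrank_sup_add_finrank_inf_eq C (B.orthogonal U)
  have h2 := Submodule.finrank_le U
  rw [h, finrank_bot, finrank_orthogonal hB] at h1
  omega

theorem LinearMap.BilinForm.inf_orthogonal_eq_bot_comm [FiniteDimensional F V]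
    (hB : B.Nondegenerate) (hR : B.IsRefl) {C U : Submodule F V} (h : C ⊓ B.orthogonal U = ⊥)
    (hd : finrank F C = finrank F U) : U ⊓ B.orthogonal C = ⊥ := by
  have h1 := finrank_sup_orthogonal_of_inf_eq_bot hB h hd
  rw [inf_comm, ← orthogonal_orthogonal hB hR U, ← orthogonal_sup, h1, orthogonal_top_eq_bot hB]

/-- The number of isotropic one-step extensions `W` of an isotropic `U` opposite to `C` that are
opposite to a given one-step extension `C'` of `C`. -/
theorem natCard_isotropic_extensions [Finite F] [FiniteDimensional F V]
    (hB : B.Nondegenerate) (hA : B.IsAlt) {C C' U : Submodule F V} {k n : ℕ}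
    (hV : finrank F V = 2 * n) (hk : k < n) (hC : finrank F C = k) (hC' : finrank F C' = k + 1)
    (hCC' : C ≤ C') (hC'i : C' ≤ B.orthogonal C) (hU : finrank F U = k)
    (hUi : U ≤ B.orthogonal U) (hCU : C ⊓ B.orthogonal U = ⊥) :
    Nat.card {W : Submodule F V // U ≤ W ∧ finrank F W = k + 1 ∧ W ≤ B.orthogonal W ∧
      C' ⊓ B.orthogonal W = ⊥} = Nat.card F ^ (2 * n - 2 * k - 1) := by
  have hR : B.IsRefl := hA.isRefl
  have hfV : Finite V := Module.finite_of_finite F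
  have hfS : Finite (Submodule F V) :=
    Finite.of_injective (fun S : Submodule F V => (S : Set V)) SetLike.coe_injective
  have hUC := LinearMap.BilinForm.inf_orthogonal_eq_bot_comm hB hR hCU (hC.trans hU.symm)
  have htop : C' ⊔ B.orthogonal U = ⊤ := by
    rw [eq_top_iff, ← LinearMap.BilinForm.finrank_sup_orthogonal_of_inf_eq_bot hB hCU
      (hC.trans hU.symm)]
    exact sup_le_sup_right hCC' _
  have hperp : finrank F (B.orthogonal U) = 2 * n - k := by
    rw [LinearMap.BilinForm.finrank_orthogonal hB, hV, hU]
  have h1 : finrank F ↥(C' ⊓ B.orthogonal U) = 1 := by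
    have := Submodule.finrank_sup_add_finrank_inf_eq C' (B.orthogonal U)
    rw [htop, finrank_top, hV, hC', hperp] at this
    omega
  obtain ⟨⟨e, heC, heU⟩, he0, hespan⟩ := finrank_eq_one_iff'.1 h1
  have he0 : e ≠ 0 := fun h => he0 (by simp [h])
  have heU' : e ∉ U := fun h => he0 (by
    have : e ∈ U ⊓ B.orthogonal C := ⟨h, hC'i heC⟩
    rwa [hUC, Submodule.mem_bot] at this)
  set H := B.orthogonal (U ⊔ F ∙ e) with hH
  have hHA : H ≤ B.orthogonal U := LinearMap.BilinForm.orthogonal_le le_sup_left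
  have hHfin : finrank F H = 2 * n - k - 1 := by
    rw [LinearMap.BilinForm.finrank_orthogonal hB, hV,
      Submodule.finrank_sup_span_singleton heU', hU]
    omega
  have hmemH : ∀ x, x ∈ H ↔ x ∈ B.orthogonal U ∧ B e x = 0 := fun x => by
    rw [hH, LinearMap.BilinForm.orthogonal_sup, Submodule.mem_inf,
      LinearMap.BilinForm.mem_orthogonal_span_singleton]
  have hUH : U ≤ H := fun u hu => (hmemH u).2 ⟨hUi hu, hR _ _ (heU u hu)⟩
  have key := natCard_mul_eq_natCard_mul
    (α := {W : Submodule F V // U ≤ W ∧ finrank F W = k + 1 ∧ W ≤ B.orthogonal W ∧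
      C' ⊓ B.orthogonal W = ⊥}) (β := {x // x ∈ B.orthogonal U ∧ x ∉ H})
    (fun W x => x.1 ∈ W.1) (m := Nat.card F ^ (k + 1) - Nat.card F ^ k) (n := 1) ?_ ?_
  · rw [Submodule.natCard_sdiff hHA, hHfin, hperp] at key
    have hq : 1 < Nat.card F := Finite.one_lt_card
    set q := Nat.card F
    obtain ⟨m, rfl⟩ : ∃ m, n = k + 1 + m := ⟨n - (k + 1), by omega⟩
    have e1 : 2 * (k + 1 + m) - k = k + 1 + (2 * m + 1) := by omega
    have e2 : 2 * (k + 1 + m) - k - 1 = k + (2 * m + 1) := by omega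
    have e3 : 2 * (k + 1 + m) - 2 * k - 1 = 2 * m + 1 := by omega
    have e4 : q ^ (k + 1 + (2 * m + 1)) - q ^ (k + (2 * m + 1)) =
        (q ^ (k + 1) - q ^ k) * q ^ (2 * m + 1) := by rw [Nat.sub_mul, ← pow_add, ← pow_add]
    rw [e2, e1, e4, mul_one, mul_comm] at key
    rw [e3]
    exact Nat.eq_of_mul_eq_mul_left
      (Nat.sub_pos_of_lt (Nat.pow_lt_pow_right hq (Nat.lt_succ_self k))) key
  · rintro ⟨W, hUW, hWf, hWi, hWC⟩
    have hcard := Submodule.natCard_sdiff hUW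
    rw [hWf, hU] at hcard
    rw [← hcard]
    refine Nat.card_congr
      ⟨fun x => ⟨x.1.1, x.2, fun h => x.1.2.2 (hUH h)⟩, fun x => ⟨⟨x.1, ?_, ?_⟩, x.2.1⟩,
        fun _ => rfl, fun _ => rfl⟩
    · exact LinearMap.BilinForm.orthogonal_le hUW (hWi x.2.1)
    · obtain ⟨x, hxW, hxU⟩ := x
      intro hx
      have hWeq : U ⊔ F ∙ x = W := by
        apply Submodule.eq_of_le_of_finrank_eq
        · exact sup_le hUW ((Submodule.span_singleton_le_iff_mem _ _).2 hxW)
        · rw [Submodule.finrank_sup_span_singleton hxU, hU, hWf]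
      have : e ∈ C' ⊓ B.orthogonal W := by
        rw [← hWeq, LinearMap.BilinForm.orthogonal_sup]
        exact ⟨heC, heU, LinearMap.BilinForm.mem_orthogonal_span_singleton.2
          (hR _ _ ((hmemH x).1 hx).2)⟩
      rw [hWC] at this
      exact he0 this
  · rintro ⟨x, hxU, hxH⟩
    have hxnU : x ∉ U := fun h => hxH (hUH h)
    have hex : B e x ≠ 0 := fun h => hxH ((hmemH x).2 ⟨hxU, h⟩)
    have hle : ∀ W : Submodule F V, U ⊔ F ∙ x ≤ W ↔ U ≤ W ∧ x ∈ W := fun W => by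
      rw [sup_le_iff, Submodule.span_singleton_le_iff_mem]
    have hfin := Submodule.finrank_sup_span_singleton hxnU
    rw [hU] at hfin
    rw [Nat.card_eq_one_iff_unique]
    refine ⟨⟨fun W W' => ?_⟩, ⟨⟨⟨U ⊔ F ∙ x, le_sup_left, hfin, ?_, ?_⟩,
      ((hle _).1 le_rfl).2⟩⟩⟩
    · obtain ⟨⟨W, hW⟩, hx⟩ := W
      obtain ⟨⟨W', hW'⟩, hx'⟩ := W'
      have a1 := Submodule.eq_of_le_of_finrank_eq ((hle W).2 ⟨hW.1, hx⟩) (hfin.trans hW.2.1.symm)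
      have a2 := Submodule.eq_of_le_of_finrank_eq ((hle W').2 ⟨hW'.1, hx'⟩)
        (hfin.trans hW'.2.1.symm)
      simp only [Subtype.mk.injEq]
      exact a1.symm.trans a2
    · rw [LinearMap.BilinForm.orthogonal_sup, hle]
      refine ⟨fun u hu => ⟨hUi hu, ?_⟩, hxU, ?_⟩
      · exact LinearMap.BilinForm.mem_orthogonal_span_singleton.2 (hR _ _ (hxU u hu))
      · exact LinearMap.BilinForm.mem_orthogonal_span_singleton.2 (hA x)
    · rw [LinearMap.BilinForm.orthogonal_sup, eq_bot_iff]
      rintro y ⟨hyC, hyU, hyx⟩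
      obtain ⟨a, ha⟩ := hespan ⟨y, hyC, hyU⟩
      have ha : a • e = y := congrArg Subtype.val ha
      have := hR _ _ (LinearMap.BilinForm.mem_orthogonal_span_singleton.1 hyx)
      rw [← ha] at this
      simp only [map_smul, LinearMap.smul_apply, smul_eq_mul, mul_eq_zero, hex, or_false] at this
      simp [← ha, this]

end LinearAlgebra

section SympFlag

variable {F : Type} [Field F] {n : ℕ} {B : LinearMap.BilinForm F (Fin (2 * n) → F)}

theorem sympMem_of_le (c : SympFlag F n B) {k : ℕ} (h : k ≤ n) :
    sympMem c k = c.1 ⟨k, by omega⟩ := by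
  rw [sympMem, dif_pos h]

theorem SympFlag.le_orthogonal (c : SympFlag F n B) :
    c.1 (Fin.last n) ≤ B.orthogonal (c.1 (Fin.last n)) :=
  fun x hx y hy => c.2.2.2 y hy x hx

theorem SympFlag.orthogonal_last (hB : B.Nondegenerate) (c : SympFlag F n B) :
    B.orthogonal (c.1 (Fin.last n)) = c.1 (Fin.last n) := by
  refine (Submodule.eq_of_le_of_finrank_eq c.le_orthogonal ?_).symm
  rw [LinearMap.BilinForm.finrank_orthogonal hB, c.2.2.1, finrank_fin_fun, Fin.val_last]
  omega

theorem sympMem_of_ge (hB : B.Nondegenerate) (c : SympFlag F n B) {k : ℕ} (h : n ≤ k) :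
    sympMem c k = B.orthogonal (c.1 ⟨2 * n - k, by omega⟩) := by
  obtain rfl | h := h.eq_or_lt
  · rw [sympMem_of_le c le_rfl]
    have e : (⟨2 * n - n, by omega⟩ : Fin (n + 1)) = Fin.last n := by ext; simp; omega
    rw [e]
    exact (c.orthogonal_last hB).symm
  · rw [sympMem, dif_neg (by omega)]
    split_ifs with h2
    · rfl
    · have h0 : c.1 ⟨2 * n - k, by omega⟩ = ⊥ := by
        rw [← Submodule.finrank_eq_zero, c.2.2.1]
        simp; omega
      rw [h0, LinearMap.BilinForm.orthogonal_bot]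

theorem orthogonal_sympMem (hB : B.Nondegenerate) (hA : B.IsAlt) (c : SympFlag F n B) {k : ℕ}
    (hk : k ≤ 2 * n) : B.orthogonal (sympMem c k) = sympMem c (2 * n - k) := by
  obtain h | h := le_total k n
  · rw [sympMem_of_le c h, sympMem_of_ge hB c (by omega)]
    have e : (⟨k, by omega⟩ : Fin (n + 1)) = ⟨2 * n - (2 * n - k), by omega⟩ := by
      ext; simp only; omega
    rw [e]
  · rw [sympMem_of_ge hB c h, sympMem_of_le c (by omega),
      LinearMap.BilinForm.orthogonal_orthogonal hB hA.isRefl]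

theorem finrank_sympMem (hB : B.Nondegenerate) (c : SympFlag F n B) {k : ℕ} (hk : k ≤ 2 * n) :
    finrank F (sympMem c k) = k := by
  obtain h | h := le_total k n
  · rw [sympMem_of_le c h, c.2.2.1]
  · rw [sympMem_of_ge hB c h, LinearMap.BilinForm.finrank_orthogonal hB, c.2.2.1, finrank_fin_fun]
    simp only
    omega

theorem sympMem_mono (hB : B.Nondegenerate) (c : SympFlag F n B) : Monotone (sympMem c) := by
  intro k l hkl
  obtain h | h := le_total l n
  · rw [sympMem_of_le c h, sympMem_of_le c (hkl.trans h)]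
    exact c.2.1 hkl
  · obtain h' | h' := le_total k n
    · rw [sympMem_of_ge hB c h, sympMem_of_le c h']
      calc c.1 ⟨k, by omega⟩ ≤ c.1 (Fin.last n) := c.2.1 (Fin.le_last _)
        _ ≤ B.orthogonal (c.1 (Fin.last n)) := c.le_orthogonal
        _ ≤ _ := LinearMap.BilinForm.orthogonal_le (c.2.1 (Fin.le_last _))
    · rw [sympMem_of_ge hB c h, sympMem_of_ge hB c h']
      exact LinearMap.BilinForm.orthogonal_le (c.2.1 (by rw [Fin.mk_le_mk]; omega))

theorem sympMem_two_mul (hB : B.Nondegenerate) (c : SympFlag F n B) :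
    sympMem c (2 * n) = ⊤ :=
  Submodule.eq_top_of_finrank_eq (by rw [finrank_sympMem hB c le_rfl, finrank_fin_fun])

theorem sympType_le_iff (hB : B.Nondegenerate) (c : SympFlag F n B)
    {X : Submodule F (Fin (2 * n) → F)} {j : ℕ} : sympType c X ≤ j ↔ X ≤ sympMem c j := by
  constructor
  · intro h
    have : X ≤ sympMem c (sympType c X) :=
      Nat.sInf_mem (s := {k : ℕ | X ≤ sympMem c k})
        ⟨2 * n, by rw [Set.mem_ofPred_eq, sympMem_two_mul hB]; exact le_top⟩
    exact this.trans (sympMem_mono hB c h)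
  · exact fun h => Nat.sInf_le h

theorem OppS.inf_eq_bot (hB : B.Nondegenerate) (hA : B.IsAlt) {c d : SympFlag F n B}
    (h : OppS c d) {i j : ℕ} (hij : i + j ≤ 2 * n) : sympMem c i ⊓ sympMem d j = ⊥ := by
  refine le_bot_iff.1 ((inf_le_inf_left _ (sympMem_mono hB d (show j ≤ 2 * n - i by omega))).trans
    (le_bot_iff.2 ?_))
  obtain hi | hi := le_total i n
  · rw [← orthogonal_sympMem hB hA d (by omega), sympMem_of_le c hi, sympMem_of_le d hi]
    exact h _
  · rw [sympMem_of_ge hB c hi, sympMem_of_le d (by omega), inf_comm]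
    exact LinearMap.BilinForm.inf_orthogonal_eq_bot_comm hB hA.isRefl (h ⟨2 * n - i, by omega⟩)
      (by rw [c.2.2.1, d.2.2.1])

theorem OppS.finrank_inf (hB : B.Nondegenerate) (hA : B.IsAlt) {c d : SympFlag F n B}
    (h : OppS c d) {i j : ℕ} (hi : i ≤ 2 * n) (hj : j ≤ 2 * n) :
    finrank F ↥(sympMem c i ⊓ sympMem d j) = i + j - 2 * n := by
  obtain hij | hij := le_total (i + j) (2 * n)
  · rw [h.inf_eq_bot hB hA hij, finrank_bot]
    omega
  · have htop : sympMem c i ⊔ sympMem d j = ⊤ := by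
      rw [← LinearMap.BilinForm.orthogonal_orthogonal hB hA.isRefl (sympMem c i ⊔ sympMem d j),
        LinearMap.BilinForm.orthogonal_sup, orthogonal_sympMem hB hA c hi,
        orthogonal_sympMem hB hA d hj, h.inf_eq_bot hB hA (by omega),
        LinearMap.BilinForm.orthogonal_bot]
    have := Submodule.finrank_sup_add_finrank_inf_eq (sympMem c i) (sympMem d j)
    rw [htop, finrank_top, finrank_fin_fun, finrank_sympMem hB c hi, finrank_sympMem hB d hj] at this
    omega

/-- The image of a flag under an isometry. -/
def SympFlag.map (g : (Fin (2 * n) → F) ≃ₗ[F] (Fin (2 * n) → F))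
    (hg : ∀ u v, B (g u) (g v) = B u v) (d : SympFlag F n B) : SympFlag F n B :=
  ⟨fun k => (d.1 k).map g.toLinearMap, fun _ _ h => Submodule.map_mono (d.2.1 h),
    fun k => (LinearEquiv.finrank_map_eq g _).trans (d.2.2.1 k), by
      rintro _ ⟨x, hx, rfl⟩ _ ⟨y, hy, rfl⟩
      exact (hg x y).trans (d.2.2.2 x hx y hy)⟩

theorem SympFlag.map_injective (g : (Fin (2 * n) → F) ≃ₗ[F] (Fin (2 * n) → F))
    (hg : ∀ u v, B (g u) (g v) = B u v) : Function.Injective (SympFlag.map g hg) := by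
  intro d d' h
  apply Subtype.ext
  funext k
  exact Submodule.map_injective_of_injective g.injective (congrFun (congrArg Subtype.val h) k)

theorem LinearMap.BilinForm.orthogonal_map {V : Type*} [AddCommGroup V] [Module F V]
    {B : LinearMap.BilinForm F V} (g : V ≃ₗ[F] V)
    (hg : ∀ u v, B (g u) (g v) = B u v) (W : Submodule F V) :
    B.orthogonal (W.map g.toLinearMap) = (B.orthogonal W).map g.toLinearMap := by
  ext x
  obtain ⟨y, rfl⟩ := g.surjective x
  rw [Submodule.mem_map_equiv, LinearEquiv.symm_apply_apply]
  constructor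
  · intro h w hw
    exact (hg w y).symm.trans (h (g w) ⟨w, hw, rfl⟩)
  · rintro h _ ⟨w, hw, rfl⟩
    exact (hg w y).trans (h w hw)

theorem sympMem_map (hB : B.Nondegenerate) (g : (Fin (2 * n) → F) ≃ₗ[F] (Fin (2 * n) → F))
    (hg : ∀ u v, B (g u) (g v) = B u v) (d : SympFlag F n B) (k : ℕ) :
    sympMem (d.map g hg) k = (sympMem d k).map g.toLinearMap := by
  obtain h | h := le_total k n
  · rw [sympMem_of_le _ h, sympMem_of_le _ h]
    rfl
  · rw [sympMem_of_ge hB _ h, sympMem_of_ge hB _ h, ← LinearMap.BilinForm.orthogonal_map g hg]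
    rfl

theorem OppS.map {c d : SympFlag F n B} (h : OppS c d)
    (g : (Fin (2 * n) → F) ≃ₗ[F] (Fin (2 * n) → F)) (hg : ∀ u v, B (g u) (g v) = B u v) :
    OppS (c.map g hg) (d.map g hg) := by
  intro k
  change (c.1 k).map g.toLinearMap ⊓ B.orthogonal ((d.1 k).map g.toLinearMap) = ⊥
  rw [LinearMap.BilinForm.orthogonal_map g hg, ← Submodule.map_inf _ g.injective, h k,
    Submodule.map_bot]

/-- The isometries fixing a maximal isotropic flag act transitively on the points of a given type
with respect to it. -/
theorem exists_isometry_map_eq (hB : B.Nondegenerate) (hA : B.IsAlt) (c : SympFlag F n B)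
    {i : ℕ} (hi : i + 1 ≤ 2 * n) {x y : Fin (2 * n) → F} (hx : x ∈ sympMem c (i + 1))
    (hx' : x ∉ sympMem c i) (hy : y ∈ sympMem c (i + 1)) (hy' : y ∉ sympMem c i) :
    ∃ (g : (Fin (2 * n) → F) ≃ₗ[F] (Fin (2 * n) → F)) (hg : ∀ u v, B (g u) (g v) = B u v)
      (a : F), c.map g hg = c ∧ a ≠ 0 ∧ g x = a • y := by
  have hR : B.IsRefl := hA.isRefl
  have hmono := sympMem_mono hB c
  have hsup : sympMem c i ⊔ F ∙ x = sympMem c (i + 1) := by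
    apply Submodule.eq_of_le_of_finrank_eq
    · exact sup_le (hmono i.le_succ) ((Submodule.span_singleton_le_iff_mem _ _).2 hx)
    · rw [Submodule.finrank_sup_span_singleton hx', finrank_sympMem hB c (by omega),
        finrank_sympMem hB c hi]
  obtain ⟨z, hz, _, hbx, hzy⟩ := Submodule.mem_sup.1 (hsup ▸ hy)
  obtain ⟨b, rfl⟩ := Submodule.mem_span_singleton.1 hbx
  have hb : b ≠ 0 := by
    rintro rfl
    rw [zero_smul, add_zero] at hzy
    exact hy' (hzy ▸ hz)
  obtain ⟨w, hw, hxw⟩ : ∃ w ∈ sympMem c i, x + w = b⁻¹ • y := by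
    refine ⟨b⁻¹ • z, Submodule.smul_mem _ _ hz, ?_⟩
    rw [← hzy, smul_add, smul_smul, inv_mul_cancel₀ hb, one_smul, add_comm]
  have hperp : B.orthogonal (sympMem c i) = sympMem c (2 * n - i) :=
    orthogonal_sympMem hB hA c (by omega)
  obtain ⟨u, hu, hxu⟩ : ∃ u ∈ sympMem c (2 * n - i), B x u = 1 := by
    by_contra! hcon
    apply hx'
    rw [← LinearMap.BilinForm.orthogonal_orthogonal hB hR (sympMem c i), hperp]
    intro v hv
    by_contra hvx
    have hxv : B x v ≠ 0 := fun h => hvx (hR _ _ h)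
    refine hcon ((B x v)⁻¹ • v) (Submodule.smul_mem _ _ hv) ?_
    rw [map_smul, smul_eq_mul, inv_mul_cancel₀ hxv]
  have hwu : B w u = 0 := by
    rw [← hperp] at hu
    exact hu w hw
  have huw : B u w = 0 := hR _ _ hwu
  let f : (Fin (2 * n) → F) →ₗ[F] (Fin (2 * n) → F) :=
    LinearMap.id + (B.flip u).smulRight w + (B.flip w - B x w • B.flip u).smulRight u
  have hf : ∀ v, f v = v + B v u • w + (B v w - B x w * B v u) • u := fun v => by simp [f]
  have hneg : ∀ v v', B v v' = - B v' v := fun v v' => (hA.neg_eq v' v).symm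
  have hiso : ∀ v v', B (f v) (f v') = B v v' := by
    intro v v'
    rw [hf, hf]
    simp only [map_add, map_smul, LinearMap.add_apply, LinearMap.smul_apply, smul_eq_mul, hwu, huw,
      show B u u = 0 from hA u, show B w w = 0 from hA w, hneg w v', hneg u v']
    ring
  have hinj : Function.Injective f := by
    rw [← LinearMap.ker_eq_bot, LinearMap.ker_eq_bot']
    intro v hv
    refine hB.1 v fun v' => ?_
    rw [← hiso, hv, map_zero, LinearMap.zero_apply]
  have hpres : ∀ k, ∀ v ∈ sympMem c k, f v ∈ sympMem c k := by
    intro k v hv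
    rw [hf]
    refine add_mem (add_mem hv ?_) ?_
    · obtain hk | hk := le_total i k
      · exact Submodule.smul_mem _ _ (hmono hk hw)
      · rw [← hperp] at hu
        rw [show B v u = 0 from hu v (hmono hk hv), zero_smul]
        exact zero_mem _
    · obtain hk | hk := le_total (2 * n - i) k
      · exact Submodule.smul_mem _ _ (hmono hk hu)
      · have hvw : B v w = 0 := by
          have : v ∈ B.orthogonal (sympMem c i) := hperp ▸ hmono hk hv
          exact hR _ _ (this w hw)
        have hxwvu : B x w * B v u = 0 := by
          obtain hk' | hk' := le_total k i
          · rw [← hperp] at hu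
            rw [show B v u = 0 from hu v (hmono hk' hv), mul_zero]
          · obtain rfl | hlt := hk'.eq_or_lt
            · rw [← hperp] at hu
              rw [show B v u = 0 from hu v hv, mul_zero]
            · have : x ∈ B.orthogonal (sympMem c i) :=
                hperp ▸ hmono (show i + 1 ≤ 2 * n - i by omega) hx
              rw [hR _ _ (this w hw), zero_mul]
        rw [hvw, hxwvu, sub_zero, zero_smul]
        exact zero_mem _
  refine ⟨LinearEquiv.ofInjectiveEndo f hinj, hiso, b⁻¹, ?_, inv_ne_zero hb, ?_⟩
  · apply Subtype.ext
    funext k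
    refine Submodule.eq_of_le_of_finrank_eq ?_ (LinearEquiv.finrank_map_eq _ _)
    rintro _ ⟨v, hv, rfl⟩
    have hk := sympMem_of_le c (Nat.le_of_lt_succ k.2)
    rw [← hk]
    refine hpres k v ?_
    rw [hk]
    exact hv
  · change f x = _
    rw [hf, hxu, ← hxw]
    simp

instance [Finite F] : Finite (SympFlag F n B) := by
  have : Finite (Submodule F (Fin (2 * n) → F)) :=
    Finite.of_injective (fun S : Submodule F (Fin (2 * n) → F) => (S : Set (Fin (2 * n) → F)))
      SetLike.coe_injective
  unfold SympFlag
  infer_instance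

theorem natCard_opposite_mem_le [Finite F] (hB : B.Nondegenerate) (hA : B.IsAlt)
    (c : SympFlag F n B) {i : ℕ} (hi : i + 1 ≤ 2 * n) {x y : Fin (2 * n) → F}
    (hx : x ∈ sympMem c (i + 1)) (hx' : x ∉ sympMem c i) (hy : y ∈ sympMem c (i + 1))
    (hy' : y ∉ sympMem c i) (j : ℕ) :
    Nat.card {d : SympFlag F n B // OppS c d ∧ x ∈ sympMem d j} ≤
      Nat.card {d : SympFlag F n B // OppS c d ∧ y ∈ sympMem d j} := by
  obtain ⟨g, hg, a, hgc, ha, hgx⟩ := exists_isometry_map_eq hB hA c hi hx hx' hy hy'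
  refine Nat.card_le_card_of_injective (Subtype.map (SympFlag.map g hg) ?_)
    (Subtype.map_injective _ (SympFlag.map_injective g hg))
  rintro d ⟨hd, hxd⟩
  refine ⟨by simpa only [hgc] using hd.map g hg, ?_⟩
  rw [sympMem_map hB, ← Submodule.smul_mem_iff _ ha, ← hgx]
  exact Submodule.mem_map_of_mem hxd

/-- Double counting of incident pairs of a vector in the `i + 1`-st cell of `c` and a flag opposite
to `c`. -/
theorem natCard_opposite_mem_mul [Finite F] (hB : B.Nondegenerate) (hA : B.IsAlt)
    (c : SympFlag F n B) {i j : ℕ} (hi : i + 1 ≤ 2 * n) (hj : j ≤ 2 * n) {x : Fin (2 * n) → F}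
    (hx : x ∈ sympMem c (i + 1)) (hx' : x ∉ sympMem c i) :
    (Nat.card F ^ (i + 1) - Nat.card F ^ i) *
      Nat.card {d : SympFlag F n B // OppS c d ∧ x ∈ sympMem d j} =
    Nat.card {d : SympFlag F n B // OppS c d} *
      (Nat.card F ^ (i + 1 + j - 2 * n) - Nat.card F ^ (i + j - 2 * n)) := by
  have hcell := Submodule.natCard_sdiff (sympMem_mono hB c i.le_succ)
  rw [Nat.succ_eq_add_one, finrank_sympMem hB c hi, finrank_sympMem hB c (by omega)] at hcell
  rw [← hcell]
  refine natCard_mul_eq_natCard_mul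
    (fun (y : {y // y ∈ sympMem c (i + 1) ∧ y ∉ sympMem c i})
      (d : {d : SympFlag F n B // OppS c d}) => y.1 ∈ sympMem d.1 j) ?_ ?_
  · rintro ⟨y, hy, hy'⟩
    rw [Nat.card_congr (Equiv.subtypeSubtypeEquivSubtypeInter (fun d => OppS c d)
      (fun d => y ∈ sympMem d j))]
    exact le_antisymm (natCard_opposite_mem_le hB hA c hi hy hy' hx hx' j)
      (natCard_opposite_mem_le hB hA c hi hx hx' hy hy' j)
  · rintro ⟨d, hd⟩
    rw [← hd.finrank_inf hB hA hi hj, ← hd.finrank_inf hB hA (i.le_succ.trans hi) hj,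
      ← Submodule.natCard_sdiff (inf_le_inf_right _ (sympMem_mono hB c i.le_succ)),
      Nat.card_congr (Equiv.subtypeSubtypeEquivSubtypeInter
        (fun y => y ∈ sympMem c (i + 1) ∧ y ∉ sympMem c i) (fun y => y ∈ sympMem d j))]
    refine Nat.card_congr (Equiv.subtypeEquivRight fun y => ?_)
    simp only [Submodule.mem_inf]
    tauto

/-- Isotropic flags of length `k` opposite to the first `k` members of `c`. -/
def PartialOppFlag (c : SympFlag F n B) (k : ℕ) : Type :=
  {U : Fin (k + 1) → Submodule F (Fin (2 * n) → F) //
    Monotone U ∧ (∀ i, finrank F (U i) = (i : ℕ)) ∧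
    U (Fin.last k) ≤ B.orthogonal (U (Fin.last k)) ∧
    ∀ i : Fin (k + 1), sympMem c i ⊓ B.orthogonal (U i) = ⊥}

instance [Finite F] (c : SympFlag F n B) (k : ℕ) : Finite (PartialOppFlag c k) := by
  have : Finite (Submodule F (Fin (2 * n) → F)) :=
    Finite.of_injective (fun S : Submodule F (Fin (2 * n) → F) => (S : Set (Fin (2 * n) → F)))
      SetLike.coe_injective
  unfold PartialOppFlag
  infer_instance

/-- Forgetting the top member of a partial flag. -/
def PartialOppFlag.dropLast {c : SympFlag F n B} {k : ℕ} (U : PartialOppFlag c (k + 1)) :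
    PartialOppFlag c k :=
  ⟨fun i => U.1 i.castSucc, fun _ _ h => U.2.1 (Fin.castSucc_le_castSucc_iff.2 h),
    fun i => U.2.2.1 i.castSucc,
    ((U.2.1 (Fin.le_last _)).trans U.2.2.2.1).trans
      (LinearMap.BilinForm.orthogonal_le (U.2.1 (Fin.le_last _))),
    fun i => U.2.2.2.2 i.castSucc⟩

/-- Adding a top member to a partial flag. -/
def PartialOppFlag.snoc {c : SympFlag F n B} {k : ℕ} (U : PartialOppFlag c k)
    (W : Submodule F (Fin (2 * n) → F)) (hUW : U.1 (Fin.last k) ≤ W)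
    (hWf : finrank F W = k + 1) (hWi : W ≤ B.orthogonal W)
    (hWC : sympMem c (k + 1) ⊓ B.orthogonal W = ⊥) : PartialOppFlag c (k + 1) :=
  ⟨Fin.snoc (α := fun _ => Submodule F (Fin (2 * n) → F)) U.1 W, by
    refine ⟨Fin.monotone_iff_le_succ.2 fun i => ?_, fun i => ?_, ?_, fun i => ?_⟩
    · rw [Fin.snoc_castSucc]
      induction i using Fin.lastCases with
      | last => rwa [Fin.succ_last, Fin.snoc_last]
      | cast i =>
        rw [Fin.succ_castSucc, Fin.snoc_castSucc]
        exact U.2.1 (Fin.castSucc_lt_succ).le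
    · induction i using Fin.lastCases with
      | last => rw [Fin.snoc_last, hWf, Fin.val_last]
      | cast i => rw [Fin.snoc_castSucc, U.2.2.1, Fin.val_castSucc]
    · rwa [Fin.snoc_last]
    · induction i using Fin.lastCases with
      | last => rwa [Fin.snoc_last]
      | cast i =>
        rw [Fin.snoc_castSucc]
        exact U.2.2.2.2 i⟩

theorem natCard_partialOppFlag [Finite F] (hB : B.Nondegenerate) (hA : B.IsAlt)
    (c : SympFlag F n B) {k : ℕ} (hk : k ≤ n) :
    Nat.card (PartialOppFlag c k) = Nat.card F ^ (k * (2 * n - k)) := by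
  induction k with
  | zero =>
    rw [zero_mul, pow_zero, Nat.card_eq_one_iff_unique]
    refine ⟨⟨fun U U' => Subtype.ext (funext fun i => ?_)⟩, ⟨⟨fun _ => ⊥, ?_⟩⟩⟩
    · have h : ∀ U : PartialOppFlag c 0, U.1 i = ⊥ := fun U => by
        rw [← Submodule.finrank_eq_zero, U.2.2.1, Fin.val_eq_zero]
      rw [h, h]
    · refine ⟨fun _ _ _ => le_rfl, fun i => by simp, bot_le, fun i => ?_⟩
      rw [LinearMap.BilinForm.orthogonal_bot, inf_top_eq, Fin.val_eq_zero,
        ← Submodule.finrank_eq_zero, finrank_sympMem hB c (Nat.zero_le _)]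
  | succ k ih =>
    have key := natCard_mul_eq_natCard_mul (α := PartialOppFlag c (k + 1))
      (β := PartialOppFlag c k) (fun U' U => U'.dropLast = U) (m := 1)
      (n := Nat.card F ^ (2 * n - 2 * k - 1)) (fun U' => ?_) (fun U => ?_)
    · rw [mul_one, ih (by omega), ← pow_add] at key
      rw [key]
      congr 1
      obtain ⟨m, rfl⟩ : ∃ m, n = k + 1 + m := ⟨n - (k + 1), by omega⟩
      have e1 : 2 * (k + 1 + m) - k = k + 2 + 2 * m := by omega
      have e2 : 2 * (k + 1 + m) - 2 * k - 1 = 1 + 2 * m := by omega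
      have e3 : 2 * (k + 1 + m) - (k + 1) = k + 1 + 2 * m := by omega
      rw [e1, e2, e3]
      ring
    · rw [Nat.card_eq_one_iff_unique]
      exact ⟨⟨fun U V => Subtype.ext (U.2.symm.trans V.2)⟩, ⟨⟨_, rfl⟩⟩⟩
    · rw [← natCard_isotropic_extensions hB hA (finrank_fin_fun F) (Nat.lt_of_succ_le hk)
        (finrank_sympMem hB c (by omega)) (finrank_sympMem hB c (show k + 1 ≤ 2 * n by omega))
        (sympMem_mono hB c k.le_succ)
        (by
          rw [orthogonal_sympMem hB hA c (by omega)]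
          exact sympMem_mono hB c (by omega))
        (U.2.2.1 (Fin.last k)) U.2.2.2.1 (U.2.2.2.2 (Fin.last k))]
      refine Nat.card_congr
        ⟨fun U' => ⟨U'.1.1 (Fin.last (k + 1)), ?_, U'.1.2.2.1 _, U'.1.2.2.2.1,
            U'.1.2.2.2.2 (Fin.last _)⟩,
          fun W => ⟨U.snoc W.1 W.2.1 W.2.2.1 W.2.2.2.1 W.2.2.2.2, ?_⟩, fun U' => ?_, fun W => ?_⟩
      · obtain ⟨U', rfl⟩ := U'
        exact U'.2.1 (Fin.le_last _)
      · exact Subtype.ext (funext fun i =>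
          Fin.snoc_castSucc (α := fun _ => Submodule F (Fin (2 * n) → F)) _ _ _)
      · obtain ⟨U', rfl⟩ := U'
        refine Subtype.ext (Subtype.ext (funext fun i => ?_))
        induction i using Fin.lastCases with
        | last => exact Fin.snoc_last (α := fun _ => Submodule F (Fin (2 * n) → F)) _ _
        | cast i => exact Fin.snoc_castSucc (α := fun _ => Submodule F (Fin (2 * n) → F)) _ _ _
      · exact Subtype.ext (Fin.snoc_last (α := fun _ => Submodule F (Fin (2 * n) → F)) _ _)

theorem natCard_opposite [Finite F] (hB : B.Nondegenerate) (hA : B.IsAlt) (c : SympFlag F n B) :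
    Nat.card {d : SympFlag F n B // OppS c d} = Nat.card F ^ n ^ 2 := by
  have h := natCard_partialOppFlag hB hA c le_rfl
  rw [show n * (2 * n - n) = n ^ 2 by rw [two_mul, Nat.add_sub_cancel, sq]] at h
  rw [← h]
  refine Nat.card_congr
    ⟨fun d => ⟨d.1.1, d.1.2.1, d.1.2.2.1, d.1.le_orthogonal, fun i => ?_⟩,
      fun U => ⟨⟨U.1, U.2.1, U.2.2.1, fun x hx y hy => U.2.2.2.1 hy x hx⟩, fun i => ?_⟩,
      fun _ => rfl, fun _ => rfl⟩
  · rw [sympMem_of_le c (Nat.le_of_lt_succ i.2)]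
    exact d.2 i
  · have := U.2.2.2.2 i
    rwa [sympMem_of_le c (Nat.le_of_lt_succ i.2)] at this

theorem natCard_opposite_mem [Finite F] (hB : B.Nondegenerate) (hA : B.IsAlt)
    (c : SympFlag F n B) {i j : ℕ} (hi : i + 1 ≤ 2 * n) (hj : j ≤ 2 * n) {x : Fin (2 * n) → F}
    (hx : x ∈ sympMem c (i + 1)) (hx' : x ∉ sympMem c i) :
    Nat.card {d : SympFlag F n B // OppS c d ∧ x ∈ sympMem d j} =
      if i + j < 2 * n then 0 else Nat.card F ^ (n ^ 2 + j - 2 * n) := by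
  have key := natCard_opposite_mem_mul hB hA c hi hj hx hx'
  rw [natCard_opposite hB hA] at key
  have hq : 1 < Nat.card F := Finite.one_lt_card
  set q := Nat.card F
  have hpos : 0 < q ^ (i + 1) - q ^ i :=
    Nat.sub_pos_of_lt (Nat.pow_lt_pow_right hq (Nat.lt_succ_self i))
  apply Nat.eq_of_mul_eq_mul_left hpos
  rw [key]
  split_ifs with hij
  · rw [Nat.sub_eq_zero_of_le (show i + 1 + j ≤ 2 * n by omega),
      Nat.sub_eq_zero_of_le (show i + j ≤ 2 * n by omega), Nat.sub_self, mul_zero, mul_zero]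
  · obtain ⟨m, hm⟩ : ∃ m, i + j = 2 * n + m := ⟨i + j - 2 * n, by omega⟩
    have hn : 2 * n ≤ n ^ 2 + j := by
      have : 2 * n ≤ n ^ 2 + 1 := by nlinarith [sq_nonneg ((n : ℤ) - 1)]
      omega
    rw [show i + 1 + j - 2 * n = m + 1 by omega, show i + j - 2 * n = m by omega,
      Nat.mul_sub, Nat.sub_mul, ← pow_add, ← pow_add, ← pow_add, ← pow_add]
    congr 2 <;> omega

end SympFlag

end

/-- Given a maximal isotropic flag `c` of type `i` w.r.t. `X`, the number of maximal
isotropic flags of type `j` w.r.t. `X` opposite to `c` is `0` if `i+j < 2n+1` and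
`(q-1+δ_{i+j,2n+1})·q^(n(n-2)+j-1)` otherwise. -/
theorem card_symp_opposite_type_j (F : Type) [Field F] [Fintype F] (q : ℕ)
    (hq : Fintype.card F = q) (n : ℕ) (hn : 2 ≤ n)
    (B : LinearMap.BilinForm F (Fin (2 * n) → F))
    (hB : B.Nondegenerate) (hBalt : ∀ v, B v v = 0)
    (X : Submodule F (Fin (2 * n) → F)) (hX : Module.finrank F X = 1)
    (i j : ℕ) (hi1 : 1 ≤ i) (hi2 : i ≤ 2 * n) (hj1 : 1 ≤ j) (hj2 : j ≤ 2 * n)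
    (c : SympFlag F n B) (hc : sympType c X = i) :
    Nat.card {d : SympFlag F n B // sympType d X = j ∧ OppS c d} =
      if i + j < 2 * n + 1 then 0
      else (q - 1 + (if i + j = 2 * n + 1 then 1 else 0)) * q ^ (n * (n - 2) + j - 1) := by
  have hA : B.IsAlt := hBalt
  have hqF : Nat.card F = q := Nat.card_eq_fintype_card.trans hq
  have hq1 : 1 < q := hqF ▸ Finite.one_lt_card
  obtain ⟨x, hx⟩ : ∃ x, X = Submodule.span F {x} := by
    obtain ⟨v, -, hv⟩ := finrank_eq_one_iff'.1 hX
    refine ⟨v, le_antisymm (fun w hw => ?_) ((Submodule.span_singleton_le_iff_mem _ _).2 v.2)⟩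
    obtain ⟨a, ha⟩ := hv ⟨w, hw⟩
    exact Submodule.mem_span_singleton.2 ⟨a, congrArg Subtype.val ha⟩
  have htype : ∀ (d : SympFlag F n B) (k : ℕ), sympType d X ≤ k ↔ x ∈ sympMem d k := fun d k => by
    rw [sympType_le_iff hB, hx, Submodule.span_singleton_le_iff_mem]
  obtain ⟨i, rfl⟩ := Nat.exists_eq_add_of_le' hi1
  obtain ⟨j, rfl⟩ := Nat.exists_eq_add_of_le' hj1
  have hmem := (htype c (i + 1)).1 hc.le
  have hmem' : x ∉ sympMem c i := fun h => by
    have := (htype c i).2 h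
    omega
  have hcount := natCard_opposite_mem hB hA c hi2 hj2 hmem hmem'
  have hcount' := natCard_opposite_mem hB hA c hi2 (j.le_succ.trans hj2) hmem hmem'
  have hsub : {d : SympFlag F n B | OppS c d ∧ x ∈ sympMem d j} ⊆
      {d : SympFlag F n B | OppS c d ∧ x ∈ sympMem d (j + 1)} :=
    fun d hd => ⟨hd.1, sympMem_mono hB d j.le_succ hd.2⟩
  have hset : {d : SympFlag F n B | sympType d X = j + 1 ∧ OppS c d} =
      {d : SympFlag F n B | OppS c d ∧ x ∈ sympMem d (j + 1)} \
        {d : SympFlag F n B | OppS c d ∧ x ∈ sympMem d j} := by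
    ext d
    change sympType d X = j + 1 ∧ OppS c d ↔
      (OppS c d ∧ x ∈ sympMem d (j + 1)) ∧ ¬(OppS c d ∧ x ∈ sympMem d j)
    rw [← htype, ← htype]
    constructor
    · rintro ⟨h1, h2⟩
      exact ⟨⟨h2, h1.le⟩, fun h => by omega⟩
    · rintro ⟨⟨h1, h2⟩, h3⟩
      have : ¬ sympType d X ≤ j := fun h => h3 ⟨h1, h⟩
      exact ⟨by omega, h1⟩
  change {d : SympFlag F n B | sympType d X = j + 1 ∧ OppS c d}.ncard = _
  change {d : SympFlag F n B | OppS c d ∧ x ∈ sympMem d (j + 1)}.ncard = _ at hcount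
  change {d : SympFlag F n B | OppS c d ∧ x ∈ sympMem d j}.ncard = _ at hcount'
  rw [hset, Set.ncard_sdiff hsub, hcount, hcount', hqF]
  obtain ⟨m, rfl⟩ : ∃ m, n = m + 2 := ⟨n - 2, by omega⟩
  have e1 : (m + 2) ^ 2 = (m + 2) * m + 2 * (m + 2) := by ring
  have e2 : (m + 2) ^ 2 + (j + 1) - 2 * (m + 2) = (m + 2) * m + j + 1 := by omega
  have e3 : (m + 2) ^ 2 + j - 2 * (m + 2) = (m + 2) * m + j := by omega
  have e4 : (m + 2) * (m + 2 - 2) + (j + 1) - 1 = (m + 2) * m + j := by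
    rw [Nat.add_sub_cancel, ← add_assoc, Nat.add_sub_cancel]
  rw [e2, e3, e4]
  obtain hij | hij | hij := lt_trichotomy (i + j + 1) (2 * (m + 2))
  · rw [if_pos (by omega), if_pos (by omega), if_pos (by omega)]
  · rw [if_neg (by omega), if_pos (by omega), if_neg (by omega), if_pos (by omega), Nat.sub_zero,
      Nat.sub_add_cancel hq1.le, pow_succ, mul_comm]
  · rw [if_neg (by omega), if_neg (by omega), if_neg (by omega), if_neg (by omega), add_zero,
      Nat.sub_mul, one_mul, pow_succ, mul_comm q]
end

section
/- Let B be a nondegenerate alternating bilinear form on F_q^{2n} with n ≥ 2, let X and Y be points, and let i,j ∈ {1,…,n}. If X = Y then |C_i^X ∩ C_j^Y| = δ_{ij}·c(n−1,1)·q^{i−1}. If X ≠ Y and X ⊆ Y^⊥ (X and Y collinear) then q·|C_i^X ∩ C_j^Y| = c(n−2,1)·q^{i−1}·(q^{j−1}−δ_{ij}) (equality of rational numbers). If X ⊄ Y^⊥ (X and Y opposite) then |C_i^X ∩ C_j^Y| = 0. (δ denotes the Kronecker delta.) -/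
open Matrix

open Module Submodule

section Counting

/-- The Gaussian integer `[k]_q = (q^k-1)/(q-1)`. -/
noncomputable def gaussInt (q : ℚ) (k : ℕ) : ℚ := (q ^ k - 1) / (q - 1)

/-- The Gaussian factorial `[k]_q!`. -/
noncomputable def gaussFact (q : ℚ) (k : ℕ) : ℚ := ∏ i ∈ Finset.Icc 1 k, gaussInt q i

theorem gaussFact_succ (q : ℚ) (k : ℕ) :
    gaussFact q (k + 1) = gaussFact q k * gaussInt q (k + 1) := by
  rw [gaussFact, gaussFact, Finset.prod_Icc_succ_top (by omega)]

theorem gaussInt_pos {q : ℚ} (hq : 1 < q) {k : ℕ} (hk : k ≠ 0) : 0 < gaussInt q k :=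
  div_pos (sub_pos.2 (one_lt_pow₀ hq hk)) (sub_pos.2 hq)

theorem gaussInt_succ_sub {q : ℚ} (hq : 1 < q) (k : ℕ) :
    gaussInt q (k + 1) - gaussInt q k = q ^ k := by
  have : q - 1 ≠ 0 := (sub_pos.2 hq).ne'
  rw [gaussInt, gaussInt]
  field_simp
  ring

theorem double_count {α β : Type*} (p : α → Prop) (s : β → Prop) (r : α → β → Prop)
    [Finite {a // p a}] [Finite {b // s b}] (c d : ℚ)
    (h1 : ∀ a, p a → (Nat.card {b // s b ∧ r a b} : ℚ) = c)
    (h2 : ∀ b, s b → (Nat.card {a // p a ∧ r a b} : ℚ) = d) :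
    (Nat.card {a // p a} : ℚ) * c = Nat.card {b // s b} * d := by
  have := Fintype.ofFinite {a // p a}
  have := Fintype.ofFinite {b // s b}
  let e : (Σ a : {a // p a}, {b : {b // s b} // r a b}) ≃
      (Σ b : {b // s b}, {a : {a // p a} // r a b}) :=
    { toFun x := ⟨x.2.1, x.1, x.2.2⟩
      invFun x := ⟨x.2.1, x.1, x.2.2⟩
      left_inv _ := rfl
      right_inv _ := rfl }
  have h := congrArg (Nat.cast : ℕ → ℚ) (Nat.card_congr e)
  rw [Nat.card_sigma, Nat.card_sigma] at h
  push_cast at h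
  have e1 : ∀ a : {a // p a}, (Nat.card {b : {b // s b} // r a b} : ℚ) = c := fun a => by
    rw [← h1 a a.2, Nat.card_congr (Equiv.subtypeSubtypeEquivSubtypeInter s (r a))]
  have e2 : ∀ b : {b // s b}, (Nat.card {a : {a // p a} // r a b} : ℚ) = d := fun b => by
    rw [← h2 b b.2, Nat.card_congr (Equiv.subtypeSubtypeEquivSubtypeInter p (r · b))]
  simpa [e1, e2] using h

theorem card_subtype_and_not {α : Type*} [Finite α] (p s : α → Prop) :
    (Nat.card {a // p a ∧ ¬ s a} : ℚ) = Nat.card {a // p a} - Nat.card {a // p a ∧ s a} := by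
  classical
  have := Fintype.ofFinite α
  simp only [Nat.card_eq_fintype_card, Fintype.card_subtype, ← Finset.filter_filter]
  rw [eq_sub_iff_add_eq, add_comm]
  exact_mod_cast Finset.card_filter_add_card_filter_not _

theorem card_subtype_eq_and {α : Type*} (p : α → Prop) (a : α) (ha : p a) :
    Nat.card {b // p b ∧ b = a} = 1 := by
  rw [Nat.card_eq_one_iff_unique]
  exact ⟨⟨fun x y => Subtype.ext (x.2.2.trans y.2.2.symm)⟩, ⟨⟨a, ha, rfl⟩⟩⟩

end Counting

section Subspaces

variable {F : Type*} [Field F] [Fintype F] {V : Type*} [AddCommGroup V] [Module F V] [Finite V]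

local notation "𝔮" => (Fintype.card F : ℚ)

theorem one_lt_card_rat (F : Type*) [Field F] [Fintype F] : 1 < (Fintype.card F : ℚ) := by
  exact_mod_cast Fintype.one_lt_card

theorem card_mem_notMem {A W : Submodule F V} (h : A ≤ W) :
    (Nat.card {v // v ∈ W ∧ v ∉ A} : ℚ) = 𝔮 ^ finrank F W - 𝔮 ^ finrank F A := by
  rw [card_subtype_and_not]
  have h' : ∀ v, (v ∈ W ∧ v ∈ A) ↔ v ∈ A := fun v => ⟨And.right, fun hv => ⟨h hv, hv⟩⟩
  simp only [h']
  have e (U : Submodule F V) : (Nat.card {v // v ∈ U} : ℚ) = 𝔮 ^ finrank F U := by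
    rw [show Nat.card {v // v ∈ U} = Nat.card U from rfl, Module.natCard_eq_pow_finrank (K := F)]
    simp
  rw [e, e]

/-- The number of subspaces of `W` covering the subspace `A`. -/
theorem card_covers {A W : Submodule F V} (h : A ≤ W) :
    (Nat.card {A' : Submodule F V // A ≤ A' ∧ A' ≤ W ∧ finrank F A' = finrank F A + 1} : ℚ) =
      gaussInt 𝔮 (finrank F W - finrank F A) := by
  have hle := Submodule.finrank_mono h
  obtain ⟨d, hd⟩ := Nat.exists_eq_add_of_le hle
  have key := double_count (fun v : V => v ∈ W ∧ v ∉ A)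
    (fun A' : Submodule F V => A ≤ A' ∧ A' ≤ W ∧ finrank F A' = finrank F A + 1)
    (fun v A' => v ∈ A') 1 (𝔮 ^ (finrank F A + 1) - 𝔮 ^ finrank F A) ?_ ?_
  · rw [card_mem_notMem h, hd] at key
    have hq := one_lt_card_rat F
    have h1 : 𝔮 - 1 ≠ 0 := (sub_pos.2 hq).ne'
    have h2 : 𝔮 ^ finrank F A ≠ 0 := by positivity
    rw [hd, Nat.add_sub_cancel_left, gaussInt, eq_div_iff h1]
    apply mul_left_cancel₀ h2
    rw [pow_add, pow_succ] at key
    linear_combination -key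
  · rintro v ⟨hv, hvA⟩
    have h3 : ∀ A' : Submodule F V,
        ((A ≤ A' ∧ A' ≤ W ∧ finrank F A' = finrank F A + 1) ∧ v ∈ A') ↔
          (True ∧ A' = A ⊔ F ∙ v) := by
      intro A'
      constructor
      · rintro ⟨⟨h1, h2, h3⟩, h4⟩
        refine ⟨trivial, (eq_of_le_of_finrank_eq (sup_le h1 ?_) ?_).symm⟩
        · simpa [span_singleton_le_iff_mem] using h4
        · rw [finrank_sup_span_singleton hvA, h3]
      · rintro ⟨-, rfl⟩
        refine ⟨⟨le_sup_left, sup_le h ?_, finrank_sup_span_singleton hvA⟩, ?_⟩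
        · simpa [span_singleton_le_iff_mem] using hv
        · exact le_sup_right (a := A) (mem_span_singleton_self v)
    simp only [h3]
    exact_mod_cast card_subtype_eq_and (fun _ => True) _ trivial
  · rintro A' ⟨h1, h2, h3⟩
    rw [← h3, ← card_mem_notMem h1]
    have : ∀ v, ((v ∈ W ∧ v ∉ A) ∧ v ∈ A') ↔ (v ∈ A' ∧ v ∉ A) := fun v =>
      ⟨fun h => ⟨h.2, h.1.2⟩, fun h => ⟨⟨h2 h.1, h.2⟩, h.1⟩⟩
    simp only [this]

/-- Double counting of the pairs `(A', W)` with `A' ≤ W` covering `A`, where `W` ranges over a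
family of subspaces of dimension `m`. -/
theorem card_above_mul_gaussInt (T : Submodule F V → Prop) {A Z : Submodule F V} (hAZ : A ≤ Z)
    {m : ℕ} (hm : ∀ W, T W → finrank F W = m) (hZ : ∀ W, T W → A ≤ W → W ≤ Z) (c : ℚ)
    (hc : ∀ A', A ≤ A' → A' ≤ Z → finrank F A' = finrank F A + 1 →
      (Nat.card {W : Submodule F V // T W ∧ A' ≤ W} : ℚ) = c) :
    (Nat.card {W : Submodule F V // T W ∧ A ≤ W} : ℚ) * gaussInt 𝔮 (m - finrank F A) =
      gaussInt 𝔮 (finrank F Z - finrank F A) * c := by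
  rw [← card_covers hAZ]
  refine double_count (fun W : Submodule F V => T W ∧ A ≤ W)
    (fun A' : Submodule F V => A ≤ A' ∧ A' ≤ Z ∧ finrank F A' = finrank F A + 1)
    (fun W A' => A' ≤ W) _ _ ?_ ?_
  · rintro W ⟨hT, hW⟩
    rw [← hm W hT, ← card_covers hW]
    have : ∀ A', ((A ≤ A' ∧ A' ≤ Z ∧ finrank F A' = finrank F A + 1) ∧ A' ≤ W) ↔
        (A ≤ A' ∧ A' ≤ W ∧ finrank F A' = finrank F A + 1) := fun A' =>
      ⟨fun h => ⟨h.1.1, h.2, h.1.2.2⟩, fun h => ⟨⟨h.1, h.2.1.trans (hZ W hT hW), h.2.2⟩, h.2.1⟩⟩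
    simp only [this]
  · rintro A' ⟨h1, h2, h3⟩
    rw [← hc A' h1 h2 h3]
    have : ∀ W, ((T W ∧ A ≤ W) ∧ A' ≤ W) ↔ (T W ∧ A' ≤ W) := fun W =>
      ⟨fun h => ⟨h.1.1, h.2⟩, fun h => ⟨⟨h.1, h1.trans h.2⟩, h.2⟩⟩
    simp only [this]

/-- The number of hyperplanes of `W` containing `A`. -/
theorem card_hyperplanes {W : Submodule F V} {n : ℕ} (hW : finrank F W = n + 1) (d : ℕ)
    {A : Submodule F V} (hAW : A ≤ W) (hA : finrank F A + d = n + 1) :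
    (Nat.card {H : Submodule F V // (H ≤ W ∧ finrank F H = n) ∧ A ≤ H} : ℚ) = gaussInt 𝔮 d := by
  have hq := one_lt_card_rat F
  induction d generalizing A with
  | zero =>
    rw [gaussInt, pow_zero, sub_self, zero_div, Nat.cast_eq_zero]
    have : IsEmpty {H : Submodule F V // (H ≤ W ∧ finrank F H = n) ∧ A ≤ H} := by
      refine ⟨fun H => ?_⟩
      have := Submodule.finrank_mono H.2.2
      have := H.2.1.2
      omega
    exact Nat.card_of_isEmpty
  | succ d ih =>
    rcases Nat.eq_zero_or_pos d with rfl | hd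
    · have : ∀ H : Submodule F V,
          ((H ≤ W ∧ finrank F H = n) ∧ A ≤ H) ↔ (True ∧ H = A) := by
        intro H
        constructor
        · rintro ⟨⟨h1, h2⟩, h3⟩
          exact ⟨trivial, (eq_of_le_of_finrank_eq h3 (by omega)).symm⟩
        · rintro ⟨-, rfl⟩
          exact ⟨⟨hAW, by omega⟩, le_rfl⟩
      simp only [this]
      rw [card_subtype_eq_and (fun _ => True) _ trivial, gaussInt, zero_add, pow_one, div_self]
      · simp
      · linarith
    · have key := card_above_mul_gaussInt (fun H : Submodule F V => H ≤ W ∧ finrank F H = n) hAW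
        (fun H h => h.2) (fun H h _ => h.1) (gaussInt 𝔮 d)
        (fun A' _ h2 h3 => ih h2 (by omega))
      rw [show n - finrank F A = d by omega, show finrank F W - finrank F A = d + 1 by omega] at key
      exact mul_right_cancel₀ (gaussInt_pos hq (by omega)).ne' key

/-- `U` is a complete flag of the `n`-dimensional subspace `W`, constant from index `n` on. -/
def IsFlag (n : ℕ) (W : Submodule F V) (U : ℕ → Submodule F V) : Prop :=
  Monotone U ∧ (∀ k, finrank F (U k) = min k n) ∧ U n = W

omit [Fintype F] in
theorem IsFlag.eq_of_le {n : ℕ} {W : Submodule F V} {U : ℕ → Submodule F V} (h : IsFlag n W U)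
    {k : ℕ} (hk : n ≤ k) : U k = W := by
  rw [← h.2.2]
  refine (eq_of_le_of_finrank_eq (h.1 hk) ?_).symm
  rw [h.2.1, h.2.1]
  omega

instance IsFlag.finite (n : ℕ) (W : Submodule F V) (P : (ℕ → Submodule F V) → Prop) :
    Finite {U // IsFlag n W U ∧ P U} := by
  refine Finite.of_injective (β := Fin n → Submodule F V) (fun U k => U.1 k) ?_
  intro U U' h
  ext1
  funext k
  rcases lt_or_ge k n with hk | hk
  · exact congrFun h ⟨k, hk⟩
  · rw [U.2.1.eq_of_le hk, U'.2.1.eq_of_le hk]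

omit [Fintype F] in
/-- A flag of `W` consists of a hyperplane of `W` and a flag of this hyperplane. -/
theorem card_flag_succ {n : ℕ} {W : Submodule F V} (hW : finrank F W = n + 1)
    {P P' : (ℕ → Submodule F V) → Prop} {Q : Submodule F V → Prop}
    (hP : ∀ U, IsFlag (n + 1) W U → (P U ↔ P' (fun k => U (min k n)) ∧ Q (U n))) {c : ℚ}
    (hc : ∀ H ≤ W, finrank F H = n → Q H → (Nat.card {U // IsFlag n H U ∧ P' U} : ℚ) = c) :
    (Nat.card {U // IsFlag (n + 1) W U ∧ P U} : ℚ) =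
      Nat.card {H : Submodule F V // (H ≤ W ∧ finrank F H = n) ∧ Q H} * c := by
  rw [← mul_one (Nat.card {U // IsFlag (n + 1) W U ∧ P U} : ℚ)]
  refine double_count _ (fun H : Submodule F V => (H ≤ W ∧ finrank F H = n) ∧ Q H)
    (fun U H => H = U n) _ _ ?_ ?_
  · rintro U ⟨hU, hPU⟩
    refine mod_cast card_subtype_eq_and _ _ ⟨⟨?_, ?_⟩, ((hP U hU).1 hPU).2⟩
    · rw [← hU.2.2]
      exact hU.1 (by omega)
    · rw [hU.2.1]
      omega
  · rintro H ⟨⟨hHW, hH⟩, hQ⟩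
    rw [← hc H hHW hH hQ]
    norm_cast
    let up (U : ℕ → Submodule F V) (k : ℕ) : Submodule F V := if k ≤ n then U k else W
    have up_flag {U} (hU : IsFlag n H U) : IsFlag (n + 1) W (up U) := by
      refine ⟨fun a b hab => ?_, fun k => ?_, by simp [up]⟩
      · by_cases hb : b ≤ n
        · simpa [up, hb, hab.trans hb] using hU.1 hab
        · by_cases ha : a ≤ n
          · simp only [up, ha, hb, if_true, if_false]
            exact (hU.1 ha).trans (hU.2.2.trans_le hHW)
          · simp [up, ha, hb]
      · by_cases hk : k ≤ n
        · rw [show up U k = U k from if_pos hk, hU.2.1]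
          omega
        · rw [show up U k = W from if_neg hk, hW]
          omega
    have down_up {U} (hU : IsFlag n H U) : (fun k => up U (min k n)) = U := by
      funext k
      rcases le_total k n with hk | hk
      · simp [up, hk]
      · simp [up, hk, hU.eq_of_le hk, hU.2.2]
    have up_n {U} (hU : IsFlag n H U) : up U n = H := by simp [up, hU.2.2]
    refine Nat.card_congr
      { toFun := fun U => ⟨fun k => U.1 (min k n), ⟨fun a b hab => U.2.1.1.1 (by omega), ?_, ?_⟩,
          ((hP _ U.2.1.1).1 U.2.1.2).1⟩
        invFun := fun U => ⟨up U.1, ⟨up_flag U.2.1, (hP _ (up_flag U.2.1)).2 ⟨?_, ?_⟩⟩,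
          (up_n U.2.1).symm⟩
        left_inv := ?_
        right_inv := fun U => Subtype.ext (down_up U.2.1) }
    · intro k
      rw [U.2.1.1.2.1]
      omega
    · simpa using U.2.2.symm
    · rw [down_up U.2.1]
      exact U.2.2
    · rw [up_n U.2.1]
      exact hQ
    · rintro ⟨U, ⟨hU, hPU⟩, rfl⟩
      ext1
      funext k
      by_cases hk : k ≤ n
      · simp [up, hk]
      · simp [up, hk, hU.eq_of_le (show n + 1 ≤ k by omega)]

omit [Fintype F] in
theorem isFlag_zero_iff {W : Submodule F V} (hW : finrank F W = 0) (U : ℕ → Submodule F V) :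
    IsFlag 0 W U ↔ (True ∧ U = fun _ => W) := by
  constructor
  · intro h
    exact ⟨trivial, funext fun k => h.eq_of_le (Nat.zero_le k)⟩
  · rintro ⟨-, rfl⟩
    exact ⟨monotone_const, fun k => by simp [hW], rfl⟩

/-- The number of complete flags of an `n`-dimensional space. -/
theorem card_flag (n : ℕ) {W : Submodule F V} (hW : finrank F W = n) :
    (Nat.card {U // IsFlag n W U ∧ True} : ℚ) = gaussFact 𝔮 n := by
  induction n generalizing W with
  | zero =>
    simp only [isFlag_zero_iff hW, and_true]
    rw [card_subtype_eq_and (fun _ => True) _ trivial]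
    simp [gaussFact]
  | succ n ih =>
    rw [card_flag_succ (P' := fun _ => True) (Q := fun H => ⊥ ≤ H) hW (by simp)
      (fun H _ hH _ => ih hH), card_hyperplanes hW (n + 1) bot_le (by simp), gaussFact_succ,
      mul_comm]

/-- `X` lies in the `i`-th member of `U` and not in the preceding one. -/
def EntersAt (X : Submodule F V) (i : ℕ) (U : ℕ → Submodule F V) : Prop :=
  X ≤ U i ∧ ¬ X ≤ U (i - 1)

omit [Fintype F] [Finite V] in
theorem entersAt_iff_of_le {n : ℕ} {W : Submodule F V} {U : ℕ → Submodule F V}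
    (hU : IsFlag (n + 1) W U) (X : Submodule F V) {i : ℕ} (hi : i ≤ n) :
    EntersAt X i U ↔ EntersAt X i (fun k => U (min k n)) ∧ X ≤ U n := by
  simp only [EntersAt, min_eq_left hi, min_eq_left ((Nat.sub_le i 1).trans hi)]
  exact ⟨fun h => ⟨h, h.1.trans (hU.1 hi)⟩, And.left⟩

omit [Fintype F] [Finite V] in
theorem entersAt_succ_iff {n : ℕ} {W : Submodule F V} {U : ℕ → Submodule F V}
    (hU : IsFlag (n + 1) W U) {X : Submodule F V} (hX : X ≤ W) :
    EntersAt X (n + 1) U ↔ ¬ X ≤ U n := by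
  simp [EntersAt, hU.2.2, hX]

theorem card_hyperplanes_not_le {W : Submodule F V} {n : ℕ} (hW : finrank F W = n + 1)
    {X : Submodule F V} (hXW : X ≤ W) (hX : finrank F X = 1) :
    (Nat.card {H : Submodule F V // (H ≤ W ∧ finrank F H = n) ∧ ¬ X ≤ H} : ℚ) = 𝔮 ^ n := by
  rw [card_subtype_and_not, card_hyperplanes hW n hXW (by omega),
    ← gaussInt_succ_sub (one_lt_card_rat F), ← card_hyperplanes hW (n + 1) bot_le (by simp)]
  simp

/-- The number of complete flags of an `n`-dimensional space whose first member containing the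
point `X` is the `i`-th one. -/
theorem card_flag_entersAt (n : ℕ) {W X : Submodule F V} (hW : finrank F W = n) (hXW : X ≤ W)
    (hX : finrank F X = 1) {i : ℕ} (hi : 1 ≤ i) (hin : i ≤ n) :
    (Nat.card {U // IsFlag n W U ∧ EntersAt X i U} : ℚ) = gaussFact 𝔮 (n - 1) * 𝔮 ^ (i - 1) := by
  induction n generalizing W with
  | zero => omega
  | succ n ih =>
    rcases Nat.lt_or_eq_of_le hin with h | rfl
    · have hin' : i ≤ n := by omega
      rw [card_flag_succ hW (fun U hU => entersAt_iff_of_le hU X hin')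
        (fun H _ hH hXH => ih hH hXH hin'), card_hyperplanes hW n hXW (by omega)]
      obtain ⟨m, rfl⟩ : ∃ m, n = m + 1 := ⟨n - 1, by omega⟩
      simp only [Nat.add_sub_cancel]
      rw [gaussFact_succ]
      ring
    · rw [card_flag_succ (P' := fun _ => True) (Q := fun H => ¬ X ≤ H) hW
        (fun U hU => by simp [entersAt_succ_iff hU hXW]) (fun H _ hH _ => card_flag n hH),
        card_hyperplanes_not_le hW hXW hX]
      simp only [Nat.add_sub_cancel]
      ring

omit [Fintype F] in
theorem finrank_sup_of_points {X Y : Submodule F V} (hXY : X ≠ Y) (hX : finrank F X = 1)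
    (hY : finrank F Y = 1) : finrank F (X ⊔ Y : Submodule F V) = 2 := by
  have h := Submodule.finrank_sup_add_finrank_inf_eq X Y
  have h0 : finrank F (X ⊓ Y : Submodule F V) ≠ 1 := by
    intro h1
    have e1 : X ⊓ Y = X := eq_of_le_of_finrank_eq inf_le_left (by omega)
    have e2 : X ⊓ Y = Y := eq_of_le_of_finrank_eq inf_le_right (by omega)
    exact hXY (e1.symm.trans e2)
  have h1 := Submodule.finrank_mono (inf_le_left : X ⊓ Y ≤ X)
  omega

theorem card_hyperplanes_le_not_le {W : Submodule F V} {n : ℕ} (hW : finrank F W = n + 1)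
    {X Y : Submodule F V} (hXY : X ≠ Y) (hXW : X ≤ W) (hX : finrank F X = 1) (hYW : Y ≤ W)
    (hY : finrank F Y = 1) :
    (Nat.card {H : Submodule F V // (H ≤ W ∧ finrank F H = n) ∧ X ≤ H ∧ ¬ Y ≤ H} : ℚ) =
      𝔮 ^ (n - 1) := by
  have h2 := finrank_sup_of_points hXY hX hY
  have hle := Submodule.finrank_mono (sup_le hXW hYW)
  obtain ⟨m, rfl⟩ : ∃ m, n = m + 1 := ⟨n - 1, by omega⟩
  simp only [← and_assoc (c := ¬ _)]
  rw [card_subtype_and_not, card_hyperplanes hW (m + 1) hXW (by omega)]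
  simp only [and_assoc (c := Y ≤ _), ← sup_le_iff]
  rw [card_hyperplanes hW m (sup_le hXW hYW) (by omega), gaussInt_succ_sub (one_lt_card_rat F),
    Nat.add_sub_cancel]

theorem card_hyperplanes_not_le_not_le {W : Submodule F V} {n : ℕ} (hW : finrank F W = n + 1)
    {X Y : Submodule F V} (hXY : X ≠ Y) (hXW : X ≤ W) (hX : finrank F X = 1) (hYW : Y ≤ W)
    (hY : finrank F Y = 1) :
    (Nat.card {H : Submodule F V // (H ≤ W ∧ finrank F H = n) ∧ ¬ X ≤ H ∧ ¬ Y ≤ H} : ℚ) =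
      𝔮 ^ n - 𝔮 ^ (n - 1) := by
  simp only [← and_assoc (c := ¬ _)]
  rw [card_subtype_and_not, card_hyperplanes_not_le hW hXW hX,
    ← card_hyperplanes_le_not_le hW hXY.symm hYW hY hXW hX]
  simp only [and_assoc, and_comm (a := Y ≤ _)]

/-- The joint distribution, for distinct points `X` and `Y`, of the positions at which they enter
a complete flag of an `n`-dimensional space. -/
theorem card_flag_entersAt_entersAt (n : ℕ) {W X Y : Submodule F V} (hW : finrank F W = n)
    (hXY : X ≠ Y) (hXW : X ≤ W) (hX : finrank F X = 1) (hYW : Y ≤ W) (hY : finrank F Y = 1)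
    {i j : ℕ} (hi : 1 ≤ i) (hin : i ≤ n) (hj : 1 ≤ j) (hjn : j ≤ n) :
    𝔮 * (Nat.card {U // IsFlag n W U ∧ EntersAt X i U ∧ EntersAt Y j U} : ℚ) =
      gaussFact 𝔮 (n - 2) * 𝔮 ^ (i - 1) * (𝔮 ^ (j - 1) - if i = j then 1 else 0) := by
  have hq := one_lt_card_rat F
  induction n generalizing W with
  | zero => omega
  | succ n ih =>
    have h2 := finrank_sup_of_points hXY hX hY
    have hle := Submodule.finrank_mono (sup_le hXW hYW)
    obtain ⟨m, rfl⟩ : ∃ m, n = m + 1 := ⟨n - 1, by omega⟩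
    rcases Nat.lt_or_eq_of_le hin with hi' | rfl <;> rcases Nat.lt_or_eq_of_le hjn with hj' | rfl
    · have hin' : i ≤ m + 1 := by omega
      have hjn' : j ≤ m + 1 := by omega
      rw [card_flag_succ (Q := fun H => X ⊔ Y ≤ H) hW
        (P' := fun U => EntersAt X i U ∧ EntersAt Y j U)
        (c := (gaussFact 𝔮 (m + 1 - 2) * 𝔮 ^ (i - 1) * (𝔮 ^ (j - 1) - if i = j then 1 else 0)) / 𝔮)
        (fun U hU => by
          rw [entersAt_iff_of_le hU X hin', entersAt_iff_of_le hU Y hjn', sup_le_iff]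
          tauto)
        (fun H _ hH hXYH => by
          rw [eq_div_iff (by positivity), mul_comm]
          rw [sup_le_iff] at hXYH
          exact ih hH hXYH.1 hXYH.2 hin' hjn'),
        card_hyperplanes hW m (sup_le hXW hYW) (by omega), mul_left_comm,
        mul_div_cancel₀ _ (by positivity)]
      rcases m with _ | m
      · obtain rfl : i = 1 := by omega
        obtain rfl : j = 1 := by omega
        simp
      · rw [show m + 1 + 1 + 1 - 2 = m + 1 by omega, show m + 1 + 1 - 2 = m by omega,
          gaussFact_succ]
        ring
    · have hin' : i ≤ m + 1 := by omega
      rw [card_flag_succ (Q := fun H => X ≤ H ∧ ¬ Y ≤ H) (P' := EntersAt X i) hW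
        (fun U hU => by
          rw [entersAt_iff_of_le hU X hin', entersAt_succ_iff hU hYW, and_assoc])
        (fun H _ hH h => card_flag_entersAt _ hH h.1 hX hi hin'),
        card_hyperplanes_le_not_le hW hXY hXW hX hYW hY, if_neg (by omega)]
      simp only [Nat.add_sub_cancel, show m + 1 + 1 - 2 = m by omega]
      ring
    · have hjn' : j ≤ m + 1 := by omega
      rw [card_flag_succ (Q := fun H => Y ≤ H ∧ ¬ X ≤ H) (P' := EntersAt Y j) hW
        (fun U hU => by
          rw [entersAt_iff_of_le hU Y hjn', entersAt_succ_iff hU hXW]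
          tauto)
        (fun H _ hH h => card_flag_entersAt _ hH h.1 hY hj hjn'),
        card_hyperplanes_le_not_le hW hXY.symm hYW hY hXW hX, if_neg (by omega)]
      simp only [Nat.add_sub_cancel, show m + 1 + 1 - 2 = m by omega]
      ring
    · rw [card_flag_succ (Q := fun H => ¬ X ≤ H ∧ ¬ Y ≤ H) (P' := fun _ => True) hW
        (fun U hU => by
          rw [entersAt_succ_iff hU hXW, entersAt_succ_iff hU hYW]
          tauto)
        (fun H _ hH _ => card_flag _ hH),
        card_hyperplanes_not_le_not_le hW hXY hXW hX hYW hY, if_pos rfl]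
      simp only [Nat.add_sub_cancel, show m + 1 + 1 - 2 = m by omega]
      rw [gaussFact_succ, gaussInt]
      have : 𝔮 - 1 ≠ 0 := (sub_pos.2 hq).ne'
      field_simp
      ring

/-- `W` is a totally isotropic subspace. -/
def IsTotallyIsotropic (B : LinearMap.BilinForm F V) (W : Submodule F V) : Prop :=
  ∀ x ∈ W, ∀ y ∈ W, B x y = 0

omit [Fintype F] in
theorem IsTotallyIsotropic.of_cover {B : LinearMap.BilinForm F V} (hBalt : ∀ v, B v v = 0)
    {A A' : Submodule F V} (hA : IsTotallyIsotropic B A) (hAA' : A ≤ A')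
    (hA' : A' ≤ B.orthogonal A) (h : finrank F A' = finrank F A + 1) :
    IsTotallyIsotropic B A' := by
  obtain ⟨v, hv, hvA⟩ : ∃ v ∈ A', v ∉ A := by
    by_contra! hle
    have := Submodule.finrank_mono (show A' ≤ A from hle)
    omega
  have e : A ⊔ F ∙ v = A' := by
    refine eq_of_le_of_finrank_eq (sup_le hAA' ?_) ?_
    · simpa [span_singleton_le_iff_mem] using hv
    · rw [finrank_sup_span_singleton hvA, h]
  have h1 : ∀ a ∈ A, B a v = 0 := fun a ha => hA' hv a ha
  have h2 : ∀ a ∈ A, B v a = 0 := fun a ha =>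
    (LinearMap.IsAlt.isRefl (B := B) hBalt) a v (h1 a ha)
  rintro x hx y hy
  rw [← e, mem_sup] at hx hy
  obtain ⟨a, ha, s, hs, rfl⟩ := hx
  obtain ⟨b, hb, t, ht, rfl⟩ := hy
  obtain ⟨s, rfl⟩ := mem_span_singleton.1 hs
  obtain ⟨t, rfl⟩ := mem_span_singleton.1 ht
  simp [hA a ha b hb, h1 a ha, h2 b hb, hBalt v]

/-- The number of maximal totally isotropic subspaces containing a totally isotropic subspace of
codimension `m` in such. -/
theorem card_maximal_isotropic {B : LinearMap.BilinForm F V} (hB : B.Nondegenerate)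
    (hBalt : ∀ v, B v v = 0) {n : ℕ} (hn : finrank F V = 2 * n) (m : ℕ) {A : Submodule F V}
    (hA : IsTotallyIsotropic B A) (hm : finrank F A + m = n) :
    (Nat.card {W : Submodule F V // (finrank F W = n ∧ IsTotallyIsotropic B W) ∧ A ≤ W} : ℚ) =
      ∏ k ∈ Finset.Icc 1 m, (𝔮 ^ k + 1) := by
  have hq := one_lt_card_rat F
  induction m generalizing A with
  | zero =>
    have : ∀ W : Submodule F V, ((finrank F W = n ∧ IsTotallyIsotropic B W) ∧ A ≤ W) ↔
        (True ∧ W = A) := by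
      intro W
      constructor
      · rintro ⟨⟨h1, -⟩, h3⟩
        exact ⟨trivial, (eq_of_le_of_finrank_eq h3 (by omega)).symm⟩
      · rintro ⟨-, rfl⟩
        exact ⟨⟨by omega, hA⟩, le_rfl⟩
    simp only [this]
    rw [card_subtype_eq_and (fun _ => True) _ trivial]
    simp
  | succ m ih =>
    have hle : A ≤ B.orthogonal A := fun y hy x hx => hA x hx y hy
    have key := card_above_mul_gaussInt
      (fun W : Submodule F V => finrank F W = n ∧ IsTotallyIsotropic B W) hle
      (fun W h => h.1) (fun W h hAW y hy x hx => h.2 x (hAW hx) y hy) _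
      (fun A' h1 h2 h3 => ih (hA.of_cover hBalt h1 h2 h3) (by omega))
    rw [LinearMap.BilinForm.finrank_orthogonal hB, hn, show n - finrank F A = m + 1 by omega,
      show 2 * n - finrank F A - finrank F A = (m + 1) * 2 by omega] at key
    refine mul_right_cancel₀ (gaussInt_pos hq (by omega : m + 1 ≠ 0)).ne' (key.trans ?_)
    rw [Finset.prod_Icc_succ_top (by omega), gaussInt, gaussInt]
    ring

end Subspaces

theorem cB_eq (q : ℚ) (k : ℕ) :
    cB q k = (∏ i ∈ Finset.Icc 1 k, (q ^ i + 1)) * gaussFact q k := by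
  rw [cB, gaussFact, ← Finset.prod_mul_distrib]
  refine Finset.prod_congr rfl fun i _ => ?_
  rw [gaussInt]
  ring

section SympFlag

variable {F : Type} [Field F] {n : ℕ} {B : LinearMap.BilinForm F (Fin (2 * n) → F)}

/-- A maximal isotropic flag as a sequence of subspaces, constant from index `n` on. -/
def SympFlag.seq (c : SympFlag F n B) (k : ℕ) : Submodule F (Fin (2 * n) → F) :=
  c.1 ⟨min k n, by omega⟩

theorem SympFlag.seq_mono (c : SympFlag F n B) : Monotone c.seq := fun _ _ hab =>
  c.2.1 (Fin.mk_le_mk.2 (min_le_min_right n hab))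

theorem sympType_eq_iff (c : SympFlag F n B) (X : Submodule F (Fin (2 * n) → F)) {i : ℕ}
    (hi : 1 ≤ i) (hin : i ≤ n) : sympType c X = i ↔ EntersAt X i c.seq := by
  have h : ∀ k ≤ n, (X ≤ sympMem c k ↔ X ≤ c.seq k) := fun k hk => by
    simp [sympMem, SympFlag.seq, hk]
  constructor
  · intro hs
    have hne : {k : ℕ | X ≤ sympMem c k}.Nonempty := Nat.nonempty_of_pos_sInf (by
      rw [sympType] at hs
      omega)
    have h1 := Nat.sInf_mem hne
    rw [show sInf {k : ℕ | X ≤ sympMem c k} = i from hs] at h1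
    refine ⟨(h i hin).1 h1, fun h2 => ?_⟩
    have h3 : sympType c X ≤ i - 1 := Nat.sInf_le ((h (i - 1) (by omega)).2 h2)
    omega
  · rintro ⟨h1, h2⟩
    refine le_antisymm (Nat.sInf_le ((h i hin).2 h1)) (le_csInf ⟨i, (h i hin).2 h1⟩ ?_)
    intro k hk
    by_contra! hki
    exact h2 (((h k (by omega)).1 hk).trans (c.seq_mono (by omega)))

variable [Fintype F]

theorem card_sympFlag_over (P : (ℕ → Submodule F (Fin (2 * n) → F)) → Prop)
    {W : Submodule F (Fin (2 * n) → F)} (hWB : IsTotallyIsotropic B W) :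
    Nat.card {c : SympFlag F n B // P c.seq ∧ W = c.seq n} =
      Nat.card {U // IsFlag n W U ∧ P U} := by
  have key {U} (hU : IsFlag n W U) : (fun k => U (min k n)) = U := by
    funext k
    rcases le_total k n with hk | hk
    · simp [hk]
    · simp [hk, hU.eq_of_le hk, hU.2.2]
  refine Nat.card_congr
    { toFun := fun c => ⟨c.1.seq, ⟨c.1.seq_mono, fun k => c.1.2.2.1 _, c.2.2.symm⟩, c.2.1⟩
      invFun := fun U => ⟨⟨fun k => U.1 k, fun a b hab => U.2.1.1 hab, fun k => ?_, ?_⟩, ?_, ?_⟩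
      left_inv := ?_
      right_inv := fun U => Subtype.ext (key U.2.1) }
  · rw [U.2.1.2.1]
    omega
  · have e : U.1 (Fin.last n : ℕ) = W := U.2.1.2.2
    intro x hx y hy
    exact hWB x (e.le hx) y (e.le hy)
  · exact (congrArg P (key U.2.1)).mpr U.2.2
  · simp [SympFlag.seq, U.2.1.2.2]
  · intro c
    apply Subtype.ext
    apply Subtype.ext
    funext k
    exact congrArg c.1.1 (Fin.ext (min_eq_left (Nat.lt_succ_iff.1 k.2)))

/-- Maximal isotropic flags whose property `P` forces `A` into the top member, counted by that
member. -/
theorem card_sympFlag (hB : B.Nondegenerate) (hBalt : ∀ v, B v v = 0)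
    {P : (ℕ → Submodule F (Fin (2 * n) → F)) → Prop} {A : Submodule F (Fin (2 * n) → F)}
    (hA : IsTotallyIsotropic B A) {m : ℕ} (hm : finrank F A + m = n)
    (hP : ∀ c : SympFlag F n B, P c.seq → A ≤ c.seq n) {d : ℚ}
    (hd : ∀ W : Submodule F (Fin (2 * n) → F), finrank F W = n → A ≤ W →
      (Nat.card {U // IsFlag n W U ∧ P U} : ℚ) = d) :
    (Nat.card {c : SympFlag F n B // P c.seq} : ℚ) =
      (∏ k ∈ Finset.Icc 1 m, ((Fintype.card F : ℚ) ^ k + 1)) * d := by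
  have : Finite (SympFlag F n B) := Subtype.finite
  rw [← card_maximal_isotropic hB hBalt (by simp) m hA hm,
    ← mul_one (Nat.card {c : SympFlag F n B // P c.seq} : ℚ)]
  refine double_count _
    (fun W : Submodule F (Fin (2 * n) → F) =>
      (finrank F W = n ∧ IsTotallyIsotropic B W) ∧ A ≤ W) (fun c W => W = c.seq n)
    _ _ (fun c hc => ?_) (fun W hW => ?_)
  · have e : c.seq n = c.1 (Fin.last n) := congrArg c.1 (Fin.ext (min_self n))
    refine mod_cast card_subtype_eq_and _ _ ⟨⟨?_, ?_⟩, hP c hc⟩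
    · rw [e, c.2.2.1, Fin.val_last]
    · rw [e]
      exact c.2.2.2
  · rw [card_sympFlag_over P hW.1.2, hd W hW.1.1 hW.2]

theorem isTotallyIsotropic_of_point (hBalt : ∀ v, B v v = 0)
    {X : Submodule F (Fin (2 * n) → F)} (hX : finrank F X = 1) : IsTotallyIsotropic B X := by
  have h0 : IsTotallyIsotropic B ⊥ := by simp [IsTotallyIsotropic]
  exact h0.of_cover hBalt bot_le (by simp) (by simpa using hX)

omit [Fintype F] in
theorem EntersAt.le_seq {c : SympFlag F n B} {X : Submodule F (Fin (2 * n) → F)} {i : ℕ}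
    (h : EntersAt X i c.seq) (hi : i ≤ n) : X ≤ c.seq n :=
  h.1.trans (c.seq_mono hi)

end SympFlag

/-- For `i,j ∈ {1,…,n}`: `|C_i^X ∩ C_j^Y| = δ_{ij}·c(n-1,1)·q^(i-1)` when `X = Y`;
`q·|C_i^X ∩ C_j^Y| = c(n-2,1)·q^(i-1)·(q^(j-1)-δ_{ij})` when `X ≠ Y` are collinear;
and `|C_i^X ∩ C_j^Y| = 0` when `X` and `Y` are opposite. -/
theorem card_symp_inter_small (F : Type) [Field F] [Fintype F] (q : ℕ)
    (hq : Fintype.card F = q) (n : ℕ) (hn : 2 ≤ n)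
    (B : LinearMap.BilinForm F (Fin (2 * n) → F))
    (hB : B.Nondegenerate) (hBalt : ∀ v, B v v = 0)
    (X Y : Submodule F (Fin (2 * n) → F))
    (hX : Module.finrank F X = 1) (hY : Module.finrank F Y = 1)
    (i j : ℕ) (hi1 : 1 ≤ i) (hi2 : i ≤ n) (hj1 : 1 ≤ j) (hj2 : j ≤ n) :
    (X = Y →
      (Nat.card {c : SympFlag F n B // sympType c X = i ∧ sympType c Y = j} : ℚ) =
        (if i = j then 1 else 0) * cB (q : ℚ) (n - 1) * (q : ℚ) ^ (i - 1)) ∧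
    (X ≠ Y → X ≤ B.orthogonal Y →
      (q : ℚ) *
          (Nat.card {c : SympFlag F n B // sympType c X = i ∧ sympType c Y = j} : ℚ) =
        cB (q : ℚ) (n - 2) * (q : ℚ) ^ (i - 1) *
          ((q : ℚ) ^ (j - 1) - (if i = j then 1 else 0))) ∧
    (¬ X ≤ B.orthogonal Y →
      Nat.card {c : SympFlag F n B // sympType c X = i ∧ sympType c Y = j} = 0) := by
  subst hq
  simp only [fun c => sympType_eq_iff (B := B) c X hi1 hi2,
    fun c => sympType_eq_iff (B := B) c Y hj1 hj2]
  refine ⟨?_, ?_, ?_⟩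
  · rintro rfl
    by_cases hij : i = j
    · subst hij
      simp only [and_self]
      rw [card_sympFlag (P := EntersAt X i) hB hBalt (isTotallyIsotropic_of_point hBalt hX)
        (by omega : _ + (n - 1) = n) (fun c hc => hc.le_seq hi2)
        (fun W hW hXW => card_flag_entersAt n hW hXW hX hi1 hi2), if_pos trivial, cB_eq]
      ring
    · rw [if_neg hij, zero_mul, zero_mul, Nat.cast_eq_zero]
      refine (Nat.card_eq_zero).2 (Or.inl ⟨?_⟩)
      rintro ⟨c, h1, h2⟩
      rcases Nat.lt_or_gt_of_ne hij with h | h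
      · exact h2.2 (h1.1.trans (c.seq_mono (by omega)))
      · exact h1.2 (h2.1.trans (c.seq_mono (by omega)))
  · intro hXY hXYB
    have h2 := finrank_sup_of_points hXY hX hY
    have hY0 := isTotallyIsotropic_of_point (B := B) hBalt hY
    have hA : IsTotallyIsotropic B (X ⊔ Y) :=
      hY0.of_cover hBalt le_sup_right
        (sup_le hXYB fun y hy x hx => hY0 x hx y hy) (by omega)
    have hcard : (Fintype.card F : ℚ) ≠ 0 := by simp
    rw [card_sympFlag (P := fun U => EntersAt X i U ∧ EntersAt Y j U) hB hBalt hA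
      (by omega : _ + (n - 2) = n)
      (fun c hc => sup_le (hc.1.le_seq hi2) (hc.2.le_seq hj2))
      (fun W hW hXYW => by
        rw [sup_le_iff] at hXYW
        exact eq_div_of_mul_eq hcard ((mul_comm _ _).trans
          (card_flag_entersAt_entersAt n hW hXY hXYW.1 hX hXYW.2 hY hi1 hi2 hj1 hj2))),
      mul_left_comm, mul_div_cancel₀ _ hcard, cB_eq]
    ring
  · intro hXYB
    refine (Nat.card_eq_zero).2 (Or.inl ⟨?_⟩)
    rintro ⟨c, h1, h2⟩
    exact hXYB fun x hx y hy =>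
      c.2.2.2 y (c.2.1 (Fin.le_last _) (h2.1 hy)) x (c.2.1 (Fin.le_last _) (h1.1 hx))
end
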